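/- Let x = x_R be the relativistic map x_R(y) = −e^{−y}. Let f be a normalized outgoing wave function and g a normalized incoming wave function such that the left limit g(0⁻) = lim_{x→0⁻} g(x) exists, and suppose there exist constants α > 0, C > 0 and L ≥ 0 such that |f(y)| ≤ C/|y|^{1+α} for all y ≤ −L. Then there exists Y such that for all y₀ ≥ Y, |N̄_g[f_{y₀}] − N̄^Th_{2π}[f_{y₀}]| ≤ (∫_{−∞}^0 |g(x)| dx)² · 4C²/(α² (y₀/2 + L)^{2α}) + e^{2L − y₀} (∫_ℝ |f(y)| dy)² |g(0⁻)|²; i.e. the mean particle number stimulated by a one-particle state is thermal at inverse temperature 2π asymptotically close to the horizon. -/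

import Mathlib

open MeasureTheory Set Filter
open scoped ENNReal

/-- The Fourier transform `f̂(p) = (2π)^{-1/2} ∫ f(y) e^{-ipy} dy`. -/
noncomputable def ft (f : ℝ → ℂ) (p : ℝ) : ℂ :=
  (Real.sqrt (2 * Real.pi) : ℂ)⁻¹ *
    ∫ y : ℝ, f y * Complex.exp (-Complex.I * (p : ℂ) * (y : ℂ))

/-- `F̌(k) = (2π)^{-1/2} ∫ f(y) e^{-ik x(y)} dy`. -/
noncomputable def Fk (x : ℝ → ℝ) (f : ℝ → ℂ) (k : ℝ) : ℂ :=
  (Real.sqrt (2 * Real.pi) : ℂ)⁻¹ *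
    ∫ y : ℝ, f y * Complex.exp (-Complex.I * (k : ℂ) * (x y : ℂ))

/-- The relativistic black-hole coordinate map `x_R(y) = -e^{-y}`. -/
noncomputable def xR (y : ℝ) : ℝ := -Real.exp (-y)

/-- The CGHS black-hole coordinate map `x_C(y) = -log(1+e^{-y})`. -/
noncomputable def xC (y : ℝ) : ℝ := -Real.log (1 + Real.exp (-y))

/-- The mean number of spontaneously created particles `N̄_o[f]`. -/
noncomputable def No (x : ℝ → ℝ) (f : ℝ → ℂ) : ℝ≥0∞ :=
  ∫⁻ k in Set.Ioi (0:ℝ), ENNReal.ofReal (‖Fk x f (-k)‖ ^ 2 / (2 * k))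

/-- The thermal mean particle number `N̄^Th_β[f]` at inverse temperature `β`. -/
noncomputable def Nth (β : ℝ) (f : ℝ → ℂ) : ℝ≥0∞ :=
  ∫⁻ p in Set.Ioi (0:ℝ),
    ENNReal.ofReal (‖ft f p‖ ^ 2 / (2 * p * (Real.exp (β * p) - 1)))

/-- translate of `f` by `y₀`. -/
noncomputable def tr (f : ℝ → ℂ) (y₀ : ℝ) : ℝ → ℂ := fun y => f (y - y₀)

/-- `⟨g̃, Af̃⟩ = ∫_0^∞ conj(ĝ(k)) F̌(k)/(2k) dk`. -/
noncomputable def Aip (x : ℝ → ℝ) (g f : ℝ → ℂ) : ℂ :=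
  ∫ k in Set.Ioi (0:ℝ), (starRingEnd ℂ) (ft g k) * Fk x f k / (2 * (k : ℂ))

/-- `⟨g̃*, Bf̃⟩ = ∫_0^∞ ĝ(k) F̌(-k)/(2k) dk`. -/
noncomputable def Bip (x : ℝ → ℝ) (g f : ℝ → ℂ) : ℂ :=
  ∫ k in Set.Ioi (0:ℝ), ft g k * Fk x f (-k) / (2 * (k : ℂ))

/-- Wald's formula: the mean number of particles emitted when the incoming state is
the one-particle state `Ω_g`:  `N̄_g[f] = N̄_o[f] + |⟨g̃,Af̃⟩|² + |⟨g̃*,Bf̃⟩|²`. -/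
noncomputable def Ng (x : ℝ → ℝ) (g f : ℝ → ℂ) : ℝ≥0∞ :=
  No x f + ENNReal.ofReal (‖Aip x g f‖ ^ 2) + ENNReal.ofReal (‖Bip x g f‖ ^ 2)

/-- A causal kernel: the difference of two decaying exponentials on the positive half-line. -/
noncomputable def expKernel (a b : ℝ) (s : ℝ) : ℂ :=
  (Set.Ioi (0:ℝ)).indicator
    (fun s : ℝ => Complex.exp (-(a : ℂ) * s) - Complex.exp (-(b : ℂ) * s)) s

/-- The (unnormalized) Fourier transform of `expKernel`. -/
noncomputable def expKernelFT (a b : ℝ) (k : ℝ) : ℂ :=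
  1 / ((a : ℂ) + Complex.I * k) - 1 / ((b : ℂ) + Complex.I * k)

lemma ofReal_add_I_mul_ne_zero {a : ℝ} (ha : 0 < a) (k : ℝ) : (a : ℂ) + Complex.I * k ≠ 0 := by
  intro h
  have := congrArg Complex.re h
  simp at this
  exact ha.ne' this

lemma continuous_expKernel {a b : ℝ} : Continuous (expKernel a b) := by
  unfold expKernel
  refine continuous_indicator ?_ (by fun_prop)
  intro x hx
  rw [frontier_Ioi] at hx
  simp at hx
  simp [hx]

lemma integrable_expKernel {a b : ℝ} (ha : 0 < a) (hb : 0 < b) :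
    Integrable (expKernel a b) := by
  unfold expKernel
  rw [integrable_indicator_iff measurableSet_Ioi]
  exact (integrableOn_exp_mul_complex_Ioi (by simpa using ha) 0).sub
    (integrableOn_exp_mul_complex_Ioi (by simpa using hb) 0)

lemma integral_exp_mul_expKernel {a b : ℝ} (ha : 0 < a) (hb : 0 < b) (k : ℝ) :
    ∫ s : ℝ, Complex.exp (-Complex.I * k * s) * expKernel a b s = expKernelFT a b k := by
  have e : ∀ s : ℝ, Complex.exp (-Complex.I * k * s) * expKernel a b s =
      (Set.Ioi (0:ℝ)).indicator (fun s : ℝ => Complex.exp (-((a : ℂ) + Complex.I * k) * s) -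
        Complex.exp (-((b : ℂ) + Complex.I * k) * s)) s := by
    intro s
    unfold expKernel
    by_cases hs : s ∈ Set.Ioi (0:ℝ)
    · rw [indicator_of_mem hs, indicator_of_mem hs, mul_sub, ← Complex.exp_add, ← Complex.exp_add]
      ring_nf
    · rw [indicator_of_notMem hs, indicator_of_notMem hs, mul_zero]
  simp_rw [e]
  rw [integral_indicator measurableSet_Ioi, integral_sub
    (integrableOn_exp_mul_complex_Ioi (by simpa using ha) 0)
    (integrableOn_exp_mul_complex_Ioi (by simpa using hb) 0),
    integral_exp_mul_complex_Ioi (by simpa using ha), integral_exp_mul_complex_Ioi (by simpa using hb)]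
  unfold expKernelFT
  have h1 := ofReal_add_I_mul_ne_zero ha k
  have h2 := ofReal_add_I_mul_ne_zero hb k
  simp only [Complex.ofReal_zero, mul_zero, Complex.exp_zero, neg_div_neg_eq]

lemma continuous_expKernelFT {a b : ℝ} (ha : 0 < a) (hb : 0 < b) :
    Continuous (expKernelFT a b) := by
  unfold expKernelFT
  exact (continuous_const.div (by fun_prop) (ofReal_add_I_mul_ne_zero ha)).sub
    (continuous_const.div (by fun_prop) (ofReal_add_I_mul_ne_zero hb))

lemma sq_norm_ofReal_add_I_mul (a k : ℝ) : ‖(a : ℂ) + Complex.I * k‖ ^ 2 = a ^ 2 + k ^ 2 := by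
  rw [← Complex.normSq_eq_norm_sq, Complex.normSq_apply]
  simp
  ring

lemma integrable_expKernelFT {a b : ℝ} (ha : 0 < a) (hb : a ≤ b) :
    Integrable (expKernelFT a b) := by
  have hb' : 0 < b := ha.trans_le hb
  have hi : Integrable (fun k : ℝ => (b - a) * (a ^ 2)⁻¹ * (1 + (k * a⁻¹) ^ 2)⁻¹) :=
    (integrable_inv_one_add_sq.comp_mul_right' (inv_ne_zero ha.ne')).const_mul _
  refine hi.mono' (continuous_expKernelFT ha hb').aestronglyMeasurable (.of_forall fun k => ?_)
  have h1 := ofReal_add_I_mul_ne_zero ha k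
  have h2 := ofReal_add_I_mul_ne_zero hb' k
  have e : expKernelFT a b k = ((b - a : ℝ) : ℂ) / (((a : ℂ) + Complex.I * k) * ((b : ℂ) + Complex.I * k)) := by
    unfold expKernelFT
    field_simp
    push_cast
    ring
  have hle : ‖(a : ℂ) + Complex.I * k‖ ≤ ‖(b : ℂ) + Complex.I * k‖ := by
    refine le_of_sq_le_sq ?_ (norm_nonneg _)
    rw [sq_norm_ofReal_add_I_mul, sq_norm_ofReal_add_I_mul]
    gcongr
  rw [e, norm_div, norm_mul, Complex.norm_real, Real.norm_of_nonneg (sub_nonneg.2 hb)]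
  have hpos : 0 < ‖(a : ℂ) + Complex.I * k‖ := norm_pos_iff.2 h1
  calc (b - a) / (‖(a : ℂ) + Complex.I * k‖ * ‖(b : ℂ) + Complex.I * k‖)
      ≤ (b - a) / (‖(a : ℂ) + Complex.I * k‖ * ‖(a : ℂ) + Complex.I * k‖) := by
        gcongr
    _ = _ := by
        rw [← sq, sq_norm_ofReal_add_I_mul]
        field_simp

lemma integral_exp_mul_expKernelFT {a b : ℝ} (ha : 0 < a) (hb : a ≤ b) (s : ℝ) :
    ∫ k : ℝ, Complex.exp (Complex.I * k * s) * expKernelFT a b k =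
      2 * Real.pi * expKernel a b s := by
  have hF : ∀ ξ : ℝ, FourierTransform.fourier (expKernel a b) ξ = expKernelFT a b (ξ * (2 * Real.pi)) := by
    intro ξ
    rw [← integral_exp_mul_expKernel ha (ha.trans_le hb), Real.fourier_eq']
    refine integral_congr_ae (.of_forall fun v => ?_)
    simp only [smul_eq_mul, RCLike.inner_apply, conj_trivial]
    congr 2
    push_cast
    ring
  have hpi : (2 * Real.pi) ≠ 0 := by positivity
  have hFi : Integrable (FourierTransform.fourier (expKernel a b)) := by
    rw [show FourierTransform.fourier (expKernel a b) = fun ξ => expKernelFT a b (ξ * (2 * Real.pi)) from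
      funext hF]
    exact (integrable_expKernelFT ha hb).comp_mul_right' hpi
  have inv := congrFun (continuous_expKernel.fourierInv_fourier_eq
    (integrable_expKernel ha (ha.trans_le hb)) hFi) s
  rw [← inv, Real.fourierInv_eq']
  have := MeasureTheory.Measure.integral_comp_mul_right
    (fun k : ℝ => Complex.exp (Complex.I * k * s) * expKernelFT a b k) (2 * Real.pi)
  rw [abs_of_pos (by positivity)] at this
  have e2 : ∀ v : ℝ, Complex.exp (↑(2 * Real.pi * inner ℝ v s) * Complex.I) •
      FourierTransform.fourier (expKernel a b) v =
      Complex.exp (Complex.I * (v * (2 * Real.pi) : ℝ) * s) * expKernelFT a b (v * (2 * Real.pi)) := by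
    intro v
    rw [hF, smul_eq_mul]
    simp only [RCLike.inner_apply, conj_trivial]
    congr 2
    push_cast
    ring
  simp_rw [e2, this]
  rw [Complex.real_smul]
  push_cast
  have : (Real.pi : ℂ) ≠ 0 := by exact_mod_cast Real.pi_ne_zero
  field_simp
  simp only [mul_right_comm]

lemma norm_expKernel_le_one {a b : ℝ} (ha : 0 < a) (hb : a ≤ b) (s : ℝ) : ‖expKernel a b s‖ ≤ 1 := by
  unfold expKernel
  by_cases hs : s ∈ Set.Ioi (0:ℝ)
  · rw [indicator_of_mem hs]
    have hs' : 0 < s := hs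
    have : Complex.exp (-(a : ℂ) * s) - Complex.exp (-(b : ℂ) * s) =
        ((Real.exp (-a * s) - Real.exp (-b * s) : ℝ) : ℂ) := by push_cast; rfl
    rw [this, Complex.norm_real, Real.norm_of_nonneg]
    · have : Real.exp (-a * s) ≤ 1 := Real.exp_le_one_iff.2 (by nlinarith)
      linarith [Real.exp_pos (-b * s)]
    · rw [sub_nonneg, Real.exp_le_exp]
      nlinarith
  · rw [indicator_of_notMem hs]; simp

lemma tendsto_expKernel (s : ℝ) : Tendsto (fun ε : ℝ => expKernel ε ε⁻¹ s) (nhdsWithin 0 (Ioi 0))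
    (nhds ((Set.Ioi (0:ℝ)).indicator 1 s)) := by
  unfold expKernel
  by_cases hs : s ∈ Set.Ioi (0:ℝ)
  · simp only [indicator_of_mem hs, Pi.one_apply]
    have hs' : 0 < s := hs
    have h1 : Tendsto (fun ε : ℝ => Complex.exp (-(ε : ℂ) * s)) (nhdsWithin 0 (Ioi 0)) (nhds 1) := by
      have : Continuous (fun ε : ℝ => Complex.exp (-(ε : ℂ) * s)) := by fun_prop
      simpa using (this.tendsto 0).mono_left nhdsWithin_le_nhds
    have h2 : Tendsto (fun ε : ℝ => Complex.exp (-((ε⁻¹ : ℝ) : ℂ) * s)) (nhdsWithin 0 (Ioi 0)) (nhds 0) := by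
      have : Tendsto (fun ε : ℝ => Real.exp (-(ε⁻¹ * s))) (nhdsWithin 0 (Ioi 0)) (nhds 0) :=
        Real.tendsto_exp_neg_atTop_nhds_zero.comp (tendsto_inv_nhdsGT_zero.atTop_mul_const hs')
      have := (Complex.continuous_ofReal.tendsto 0).comp this
      simpa [Function.comp_def] using this
    simpa using h1.sub h2
  · simp only [indicator_of_notMem hs]
    exact tendsto_const_nhds

lemma norm_I_mul_div_le_one {a : ℝ} (ha : 0 < a) (k : ℝ) :
    ‖Complex.I * k / ((a : ℂ) + Complex.I * k)‖ ≤ 1 := by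
  rw [norm_div]
  refine div_le_one_of_le₀ ?_ (norm_nonneg _)
  refine le_of_sq_le_sq ?_ (norm_nonneg _)
  rw [sq_norm_ofReal_add_I_mul]
  simp
  positivity

lemma norm_mul_expKernelFT_le {a b : ℝ} (ha : 0 < a) (hb : 0 < b) (k : ℝ) :
    ‖Complex.I * k * expKernelFT a b k‖ ≤ 2 := by
  have : Complex.I * k * expKernelFT a b k = Complex.I * k / ((a : ℂ) + Complex.I * k) -
      Complex.I * k / ((b : ℂ) + Complex.I * k) := by unfold expKernelFT; ring
  rw [this]
  linarith [norm_sub_le (Complex.I * k / ((a : ℂ) + Complex.I * k)) (Complex.I * k / ((b : ℂ) + Complex.I * k)),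
    norm_I_mul_div_le_one ha k, norm_I_mul_div_le_one hb k]

lemma tendsto_mul_expKernelFT {k : ℝ} (hk : k ≠ 0) :
    Tendsto (fun ε : ℝ => Complex.I * k * expKernelFT ε ε⁻¹ k) (nhdsWithin 0 (Ioi 0)) (nhds 1) := by
  have hk' : (k : ℂ) ≠ 0 := by exact_mod_cast hk
  have h1 : Tendsto (fun ε : ℝ => Complex.I * k / ((ε : ℂ) + Complex.I * k)) (nhdsWithin 0 (Ioi 0)) (nhds 1) := by
    have : ContinuousAt (fun ε : ℝ => Complex.I * k / ((ε : ℂ) + Complex.I * k)) 0 := by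
      refine ContinuousAt.div (by fun_prop) (by fun_prop) ?_
      simp [hk]
    have := this.tendsto.mono_left (nhdsWithin_le_nhds (s := Ioi 0))
    simpa [hk'] using this
  have h2 : Tendsto (fun ε : ℝ => Complex.I * k / (((ε⁻¹ : ℝ) : ℂ) + Complex.I * k)) (nhdsWithin 0 (Ioi 0)) (nhds 0) := by
    have : ContinuousAt (fun ε : ℝ => Complex.I * k * ε / (1 + Complex.I * k * ε)) 0 := by
      refine ContinuousAt.div (by fun_prop) (by fun_prop) ?_
      simp
    have := this.tendsto.mono_left (nhdsWithin_le_nhds (s := Ioi 0))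
    simp only [Complex.ofReal_zero, mul_zero, zero_div] at this
    refine this.congr' ?_
    filter_upwards [self_mem_nhdsWithin] with ε hε
    have hε' : (ε : ℂ) ≠ 0 := by exact_mod_cast (ne_of_gt hε)
    have : (1 : ℂ) + Complex.I * k * ε = ε * (((ε⁻¹ : ℝ) : ℂ) + Complex.I * k) := by
      push_cast; field_simp
    rw [this, mul_comm (Complex.I * (k:ℂ)) (ε:ℂ), mul_div_mul_left _ _ hε']
  have := h1.sub h2
  rw [sub_zero] at this
  refine this.congr fun ε => ?_
  unfold expKernelFT
  ring

lemma inv_sqrt_two_pi_mul_self :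
    (Real.sqrt (2 * Real.pi) : ℂ)⁻¹ * (Real.sqrt (2 * Real.pi) : ℂ)⁻¹ = (2 * Real.pi : ℂ)⁻¹ := by
  rw [← mul_inv, ← Complex.ofReal_mul, Real.mul_self_sqrt (by positivity)]
  push_cast
  rfl

lemma norm_exp_neg_I_mul (p y : ℝ) : ‖Complex.exp (-Complex.I * (p : ℂ) * (y : ℂ))‖ = 1 := by
  rw [show -Complex.I * (p : ℂ) * (y : ℂ) = ((-(p * y) : ℝ) : ℂ) * Complex.I by push_cast; ring]
  exact Complex.norm_exp_ofReal_mul_I _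

lemma integral_ft_mul_expKernelFT_mul_Fk {X : ℝ → ℝ} (hX : Continuous X) {g h : ℝ → ℂ}
    (hg : Integrable g) (hh : Integrable h) {a b : ℝ} (ha : 0 < a) (hb : a ≤ b) :
    ∫ k, ft g k * expKernelFT a b k * Fk X h (-k) =
      ∫ z : ℝ × ℝ, g z.1 * h z.2 * expKernel a b (X z.2 - z.1) := by
  have hgh : Integrable (fun z : ℝ × ℝ => g z.1 * h z.2) := hg.mul_prod hh
  have e1 : ∀ k : ℝ, ft g k * expKernelFT a b k * Fk X h (-k) =
      ∫ z : ℝ × ℝ, (2 * Real.pi : ℂ)⁻¹ * (Complex.exp (Complex.I * k * (X z.2 - z.1 : ℝ)) *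
        (expKernelFT a b k * (g z.1 * h z.2))) := by
    intro k
    rw [integral_const_mul, ← inv_sqrt_two_pi_mul_self]
    have : ∀ z : ℝ × ℝ, Complex.exp (Complex.I * k * (X z.2 - z.1 : ℝ)) *
        (expKernelFT a b k * (g z.1 * h z.2)) = expKernelFT a b k *
        ((g z.1 * Complex.exp (-Complex.I * (k : ℂ) * (z.1 : ℂ))) *
          (h z.2 * Complex.exp (-Complex.I * ((-k : ℝ) : ℂ) * (X z.2 : ℂ)))) := by
      intro z
      rw [show Complex.I * k * ((X z.2 - z.1 : ℝ) : ℂ) = -Complex.I * (k : ℂ) * (z.1 : ℂ) +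
        -Complex.I * ((-k : ℝ) : ℂ) * (X z.2 : ℂ) by push_cast; ring, Complex.exp_add]
      ring
    simp_rw [this]
    rw [integral_const_mul]
    have := integral_prod_mul (μ := volume) (ν := volume)
      (fun t : ℝ => g t * Complex.exp (-Complex.I * (k : ℂ) * (t : ℂ)))
      (fun y : ℝ => h y * Complex.exp (-Complex.I * ((-k : ℝ) : ℂ) * (X y : ℂ)))
    rw [← Measure.volume_eq_prod] at this
    rw [this]
    unfold ft Fk
    ring
  simp_rw [e1]
  rw [integral_integral_swap]
  · congr 1 with z
    rw [integral_const_mul]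
    have : ∀ k : ℝ, Complex.exp (Complex.I * k * (X z.2 - z.1 : ℝ)) *
        (expKernelFT a b k * (g z.1 * h z.2)) = (g z.1 * h z.2) *
        (Complex.exp (Complex.I * k * (X z.2 - z.1 : ℝ)) * expKernelFT a b k) := by
      intro k; ring
    simp_rw [this]
    rw [integral_const_mul, integral_exp_mul_expKernelFT ha hb]
    have : (Real.pi : ℂ) ≠ 0 := by exact_mod_cast Real.pi_ne_zero
    field_simp
  · refine Integrable.const_mul ?_ _
    refine ((integrable_expKernelFT ha hb).mul_prod hgh).bdd_mul (c := 1) ?_ ?_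
    · refine Continuous.aestronglyMeasurable ?_
      fun_prop
    · refine .of_forall fun z => ?_
      rw [show Complex.I * (z.1 : ℂ) * ((X z.2.2 - z.2.1 : ℝ) : ℂ) =
        ((z.1 * (X z.2.2 - z.2.1) : ℝ) : ℂ) * Complex.I by push_cast; ring,
        Complex.norm_exp_ofReal_mul_I]

lemma continuous_ft {g : ℝ → ℂ} (hg : Integrable g) : Continuous (ft g) := by
  unfold ft
  refine continuous_const.mul (continuous_of_dominated (bound := fun y => ‖g y‖) ?_ ?_ hg.norm ?_)
  · intro p
    exact hg.aestronglyMeasurable.mul (Continuous.aestronglyMeasurable (by fun_prop))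
  · intro p
    refine .of_forall fun y => ?_
    rw [norm_mul, norm_exp_neg_I_mul, mul_one]
  · exact .of_forall fun y => by fun_prop

lemma integral_eq_zero_of_ft_eq_zero {f : ℝ → ℂ} (hf : Integrable f)
    (hfp : ∀ᵐ p : ℝ, p ≤ 0 → ft f p = 0) : ∫ y, f y = 0 := by
  have h0 : ft f 0 = 0 := by
    by_contra hne
    have hev := (continuous_ft hf).continuousAt.eventually_ne hne
    obtain ⟨ε, hε, hb⟩ := Metric.eventually_nhds_iff_ball.1 hev
    have hsub : Ioo (-ε) 0 ⊆ {p : ℝ | ¬ (p ≤ 0 → ft f p = 0)} := by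
      intro p hp
      simp only [mem_ofPred_eq, Classical.not_imp]
      refine ⟨hp.2.le, hb p ?_⟩
      rw [Metric.mem_ball, Real.dist_eq, sub_zero, abs_lt]
      exact ⟨hp.1, hp.2.trans hε⟩
    have := measure_mono_null hsub (ae_iff.1 hfp)
    rw [Real.volume_Ioo, ENNReal.ofReal_eq_zero] at this
    linarith
  unfold ft at h0
  have hs : (Real.sqrt (2 * Real.pi) : ℂ)⁻¹ ≠ 0 := by
    rw [ne_eq, inv_eq_zero, Complex.ofReal_eq_zero, Real.sqrt_eq_zero']
    push Not
    positivity
  have := (mul_eq_zero.1 h0).resolve_left hs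
  simpa using this

lemma norm_integral_ft_mul_Fk_le {X : ℝ → ℝ} (hX : Continuous X) (hX0 : ∀ y, X y ≤ 0) {g h : ℝ → ℂ}
    (hg : Integrable g) (hgp : ∀ᵐ k : ℝ, k ≤ 0 → ft g k = 0)
    (hh : Integrable h) (hh0 : ∫ y, h y = 0) :
    ‖∫ k in Ioi (0:ℝ), ft g k * Fk X h (-k) / (2 * (k : ℂ))‖ ≤
      1 / 2 * ∫ y, ‖h y‖ * ∫ t in Ico (X y) 0, ‖g t‖ := by
  have hgh : Integrable (fun z : ℝ × ℝ => g z.1 * h z.2) := hg.mul_prod hh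
  by_cases hi : IntegrableOn (fun k : ℝ => ft g k * Fk X h (-k) / (2 * (k : ℂ))) (Ioi 0)
  swap
  · rw [integral_undef hi, norm_zero]
    refine mul_nonneg (by norm_num) (integral_nonneg fun y => ?_)
    exact mul_nonneg (norm_nonneg _) (integral_nonneg fun _ => norm_nonneg _)
  have hL : Tendsto (fun ε : ℝ => ∫ k in Ioi (0:ℝ), (Complex.I * k * expKernelFT ε ε⁻¹ k) *
      (ft g k * Fk X h (-k) / (2 * (k : ℂ)))) (nhdsWithin 0 (Ioi 0))
      (nhds (∫ k in Ioi (0:ℝ), ft g k * Fk X h (-k) / (2 * (k : ℂ)))) := by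
    refine tendsto_integral_filter_of_dominated_convergence
      (fun k : ℝ => 2 * ‖ft g k * Fk X h (-k) / (2 * (k : ℂ))‖) ?_ ?_ (hi.norm.const_mul 2) ?_
    · filter_upwards [self_mem_nhdsWithin] with ε hε
      refine AEStronglyMeasurable.mul (Continuous.aestronglyMeasurable ?_) hi.aestronglyMeasurable
      have := continuous_expKernelFT (show 0 < ε from hε) (inv_pos.2 (show 0 < ε from hε))
      fun_prop
    · filter_upwards [self_mem_nhdsWithin] with ε hε
      refine .of_forall fun k => ?_
      rw [norm_mul]
      gcongr
      exact norm_mul_expKernelFT_le hε (inv_pos.2 hε) k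
    · filter_upwards [ae_restrict_mem measurableSet_Ioi] with k hk
      simpa using (tendsto_mul_expKernelFT (ne_of_gt hk)).mul_const _
  have hR : Tendsto (fun ε : ℝ => Complex.I / 2 *
        ∫ z : ℝ × ℝ, g z.1 * h z.2 * expKernel ε ε⁻¹ (X z.2 - z.1))
      (nhdsWithin 0 (Ioi 0)) (nhds (Complex.I / 2 *
        ∫ z : ℝ × ℝ, g z.1 * h z.2 * (Ioi (0:ℝ)).indicator 1 (X z.2 - z.1))) := by
    refine Tendsto.const_mul _ (tendsto_integral_filter_of_dominated_convergence
      (fun z : ℝ × ℝ => ‖g z.1 * h z.2‖) ?_ ?_ hgh.norm ?_)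
    · refine .of_forall fun ε => hgh.aestronglyMeasurable.mul (Continuous.aestronglyMeasurable ?_)
      have := continuous_expKernel (a := ε) (b := ε⁻¹)
      fun_prop
    · filter_upwards [Ioo_mem_nhdsGT (zero_lt_one' ℝ)] with ε hε
      refine .of_forall fun z => ?_
      rw [norm_mul]
      refine mul_le_of_le_one_right (norm_nonneg _) (norm_expKernel_le_one hε.1 ?_ _)
      exact hε.2.le.trans (one_le_inv₀ hε.1 |>.2 hε.2.le)
    · exact .of_forall fun z => (tendsto_expKernel _).const_mul _
  have hE : ∀ᶠ ε : ℝ in nhdsWithin 0 (Ioi 0), Complex.I / 2 *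
        ∫ z : ℝ × ℝ, g z.1 * h z.2 * expKernel ε ε⁻¹ (X z.2 - z.1) =
      ∫ k in Ioi (0:ℝ), (Complex.I * k * expKernelFT ε ε⁻¹ k) *
      (ft g k * Fk X h (-k) / (2 * (k : ℂ))) := by
    filter_upwards [Ioo_mem_nhdsGT (zero_lt_one' ℝ)] with ε hε
    rw [← integral_ft_mul_expKernelFT_mul_Fk hX hg hh hε.1
      (hε.2.le.trans (one_le_inv₀ hε.1 |>.2 hε.2.le)), ← integral_const_mul]
    rw [← setIntegral_eq_integral_of_ae_compl_eq_zero (s := Ioi 0)]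
    · refine setIntegral_congr_fun measurableSet_Ioi fun k hk => ?_
      have : (k : ℂ) ≠ 0 := by exact_mod_cast (ne_of_gt hk)
      field_simp
    · filter_upwards [hgp] with k hk hk'
      rw [hk (not_lt.1 hk')]
      simp
  rw [tendsto_nhds_unique hL (hR.congr' hE)]
  have hgh' : Integrable (fun z : ℝ × ℝ => g z.1 * h z.2 *
      (Ioi (0:ℝ)).indicator 1 (X z.2 - z.1)) := by
    refine hgh.mul_bdd (c := 1) ?_ ?_
    · have : Measurable fun z : ℝ × ℝ => (Ioi (0:ℝ)).indicator (1 : ℝ → ℂ) (X z.2 - z.1) :=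
        (measurable_one.indicator measurableSet_Ioi).comp (by fun_prop)
      exact this.aestronglyMeasurable
    · refine .of_forall fun z => ?_
      by_cases hz : (X z.2 - z.1) ∈ Ioi (0:ℝ)
      · rw [indicator_of_mem hz]; simp
      · rw [indicator_of_notMem hz]; simp
  have hslice : ∀ y, ∫ t, g t * h y * (Ioi (0:ℝ)).indicator 1 (X y - t) =
      h y * ∫ t in Iio (X y), g t := by
    intro y
    rw [← integral_indicator measurableSet_Iio, ← integral_const_mul]
    congr 1 with t
    by_cases ht : t < X y
    · rw [indicator_of_mem (by simpa using ht), indicator_of_mem (by simpa using ht)]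
      simp [mul_comm]
    · rw [indicator_of_notMem (by simpa using ht), indicator_of_notMem (by simpa using ht)]
      simp
  have hval : ∫ z : ℝ × ℝ, g z.1 * h z.2 * (Ioi (0:ℝ)).indicator 1 (X z.2 - z.1) =
      ∫ y, h y * ∫ t in Iio (X y), g t := by
    rw [Measure.volume_eq_prod, integral_prod_symm _ (by rwa [← Measure.volume_eq_prod])]
    refine integral_congr_ae (.of_forall fun y => ?_)
    exact hslice y
  have hval2 : ∫ y, h y * ∫ t in Iio (X y), g t = - ∫ y, h y * ∫ t in Ico (X y) 0, g t := by
    have hsplit : ∀ y, h y * ∫ t in Iio (X y), g t =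
        h y * (∫ t in Iio (0:ℝ), g t) - h y * ∫ t in Ico (X y) 0, g t := by
      intro y
      have : Iio (0:ℝ) = Iio (X y) ∪ Ico (X y) 0 := (Iio_union_Ico_eq_Iio (hX0 y)).symm
      rw [this, setIntegral_union _ measurableSet_Ico hg.integrableOn hg.integrableOn]
      · ring
      · rw [Set.disjoint_left]
        intro t ht ht'
        exact absurd ht'.1 (not_le.2 ht)
    have hint : Integrable fun y => h y * ∫ t in Iio (X y), g t := by
      have := (by rwa [← Measure.volume_eq_prod] : Integrable (fun z : ℝ × ℝ => g z.1 * h z.2 *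
        (Ioi (0:ℝ)).indicator 1 (X z.2 - z.1)) (volume.prod volume)).integral_prod_right
      exact this.congr (.of_forall hslice)
    have hint2 : Integrable fun y => h y * ∫ t in Ico (X y) 0, g t := by
      refine ((hh.mul_const (∫ t in Iio (0:ℝ), g t)).sub hint).congr (.of_forall fun y => ?_)
      simp only [Pi.sub_apply, hsplit]
      ring
    simp_rw [hsplit]
    rw [integral_sub (hh.mul_const _) hint2, integral_mul_const, hh0]
    simp
  rw [hval, hval2, norm_mul, norm_neg]
  have : ‖Complex.I / 2‖ = 1 / 2 := by simp
  rw [this]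
  gcongr
  have hmeas : AEStronglyMeasurable (fun y => ∫ t in Ico (X y) 0, ‖g t‖) volume := by
    have hm : Monotone fun x : ℝ => -∫ t in Ico x 0, ‖g t‖ := by
      intro x x' hx
      refine neg_le_neg (setIntegral_mono_set hg.norm.integrableOn
        (.of_forall fun _ => norm_nonneg _) (Ico_subset_Ico_left hx).eventuallyLE)
    have := (hm.measurable.comp hX.measurable).neg
    simp only [Function.comp_def, Pi.neg_def, neg_neg] at this
    exact this.aestronglyMeasurable
  refine norm_integral_le_of_norm_le ?_ (.of_forall fun y => ?_)
  · refine hh.norm.mul_bdd (c := ∫ t, ‖g t‖) hmeas (.of_forall fun y => ?_)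
    rw [Real.norm_of_nonneg (integral_nonneg fun _ => norm_nonneg _)]
    exact setIntegral_le_integral hg.norm (.of_forall fun _ => norm_nonneg _)
  · rw [norm_mul]
    gcongr
    exact norm_integral_le_integral_norm _

lemma conj_Fk (X : ℝ → ℝ) (f : ℝ → ℂ) (k : ℝ) :
    (starRingEnd ℂ) (Fk X f k) = Fk X (fun y => (starRingEnd ℂ) (f y)) (-k) := by
  unfold Fk
  rw [map_mul, map_inv₀, Complex.conj_ofReal, ← integral_conj]
  congr 2 with y
  rw [map_mul, ← Complex.exp_conj]
  simp

lemma norm_Bip_le {X : ℝ → ℝ} (hX : Continuous X) (hX0 : ∀ y, X y ≤ 0) {g f : ℝ → ℂ}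
    (hg : Integrable g) (hgp : ∀ᵐ k : ℝ, k ≤ 0 → ft g k = 0)
    (hf : Integrable f) (hf0 : ∫ y, f y = 0) :
    ‖Bip X g f‖ ≤ 1 / 2 * ∫ y, ‖f y‖ * ∫ t in Ico (X y) 0, ‖g t‖ :=
  norm_integral_ft_mul_Fk_le hX hX0 hg hgp hf hf0

lemma norm_Aip_le {X : ℝ → ℝ} (hX : Continuous X) (hX0 : ∀ y, X y ≤ 0) {g f : ℝ → ℂ}
    (hg : Integrable g) (hgp : ∀ᵐ k : ℝ, k ≤ 0 → ft g k = 0)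
    (hf : Integrable f) (hf0 : ∫ y, f y = 0) :
    ‖Aip X g f‖ ≤ 1 / 2 * ∫ y, ‖f y‖ * ∫ t in Ico (X y) 0, ‖g t‖ := by
  have := norm_integral_ft_mul_Fk_le hX hX0 hg hgp (h := fun y => (starRingEnd ℂ) (f y))
    (hf.norm.mono' (Complex.continuous_conj.comp_aestronglyMeasurable hf.aestronglyMeasurable)
      (.of_forall fun y => by simp)) (by rw [integral_conj, hf0, map_zero])
  simp only [RCLike.norm_conj] at this
  refine le_trans (le_of_eq ?_) this
  rw [← RCLike.norm_conj (Aip X g f)]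
  unfold Aip
  rw [← integral_conj]
  congr 2 with k
  rw [map_div₀, map_mul, conj_Fk]
  simp [Complex.conj_ofNat]

lemma continuous_xR : Continuous xR := by unfold xR; fun_prop

lemma xR_neg (y : ℝ) : xR y < 0 := by unfold xR; simpa using Real.exp_pos _

lemma integral_norm_Iic_le {f : ℝ → ℂ} {α C L M : ℝ} (hα : 0 < α)
    (hM : 0 < M) (hLM : L ≤ M) (hdecay : ∀ y : ℝ, y ≤ -L → ‖f y‖ ≤ C / |y| ^ (1 + α)) :
    ∫ y in Iic (-M), ‖f y‖ ≤ C / (α * M ^ α) := by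
  have hint : IntegrableOn (fun y : ℝ => y ^ (-(1 + α))) (Ioi M) :=
    integrableOn_Ioi_rpow_of_lt (by linarith) hM
  rw [show ∫ y in Iic (-M), ‖f y‖ = ∫ y in Ioi M, ‖f (-y)‖ from
    (integral_comp_neg_Ioi M (fun y => ‖f y‖)).symm]
  calc ∫ y in Ioi M, ‖f (-y)‖ ≤ ∫ y in Ioi M, C * y ^ (-(1 + α)) := by
        refine integral_mono_of_nonneg (.of_forall fun _ => norm_nonneg _) (hint.const_mul C) ?_
        filter_upwards [ae_restrict_mem measurableSet_Ioi] with y hy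
        have hy' : M < y := hy
        have := hdecay (-y) (by linarith)
        rwa [abs_neg, abs_of_pos (hM.trans hy'), div_eq_mul_inv,
          ← Real.rpow_neg (hM.trans hy').le] at this
    _ = C / (α * M ^ α) := by
        rw [integral_const_mul, integral_Ioi_rpow_of_lt (by linarith) hM,
          show -(1 + α) + 1 = -α by ring, Real.rpow_neg hM.le]
        field_simp

lemma integral_norm_tr_mul_le {f g : ℝ → ℂ} (hf : Integrable f) (hg : Integrable g)
    {α C L B η y₀ : ℝ} (hα : 0 < α) (hM : 0 < y₀ / 2 + L) (hy₀ : 0 ≤ y₀)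
    (hdecay : ∀ y : ℝ, y ≤ -L → ‖f y‖ ≤ C / |y| ^ (1 + α)) (hB : 0 ≤ B)
    (hgB : ∀ t ∈ Ioo (-η) 0, ‖g t‖ ≤ B) (hη : Real.exp (L - y₀ / 2) < η) :
    ∫ y, ‖tr f y₀ y‖ * ∫ t in Ico (xR y) 0, ‖g t‖ ≤
      (∫ t in Iio (0:ℝ), ‖g t‖) * (C / (α * (y₀ / 2 + L) ^ α)) +
        B * Real.exp (L - y₀ / 2) * ∫ y, ‖f y‖ := by
  set M := y₀ / 2 + L with hMdef
  set G := ∫ t in Iio (0:ℝ), ‖g t‖ with hG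
  have hG0 : 0 ≤ G := integral_nonneg fun _ => norm_nonneg _
  have hshift := integral_add_right_eq_self
    (fun y => ‖tr f y₀ y‖ * ∫ t in Ico (xR y) 0, ‖g t‖) y₀ (μ := volume)
  rw [← hshift]
  unfold tr
  simp only [add_sub_cancel_right]
  have hbound : Integrable fun y => G * (Iic (-M)).indicator (fun y => ‖f y‖) y +
      B * Real.exp (L - y₀ / 2) * ‖f y‖ :=
    ((hf.norm.indicator measurableSet_Iic).const_mul G).add (hf.norm.const_mul _)
  calc ∫ y, ‖f y‖ * ∫ t in Ico (xR (y + y₀)) 0, ‖g t‖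
      ≤ ∫ y, (G * (Iic (-M)).indicator (fun y => ‖f y‖) y +
      B * Real.exp (L - y₀ / 2) * ‖f y‖) := by
        refine integral_mono_of_nonneg (.of_forall fun y => ?_) hbound (.of_forall fun y => ?_)
        · exact mul_nonneg (norm_nonneg _) (integral_nonneg fun _ => norm_nonneg _)
        simp only
        by_cases hy : y ∈ Iic (-M)
        · rw [indicator_of_mem hy, mul_comm]
          have h1 : ∫ t in Ico (xR (y + y₀)) 0, ‖g t‖ ≤ G :=
            setIntegral_mono_set hg.norm.integrableOn (.of_forall fun _ => norm_nonneg _)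
              (Ico_subset_Iio_self).eventuallyLE
          have h2 : 0 ≤ B * Real.exp (L - y₀ / 2) * ‖f y‖ := by positivity
          nlinarith [mul_le_mul_of_nonneg_right h1 (norm_nonneg (f y))]
        · rw [indicator_of_notMem hy, mul_zero, zero_add, mul_comm]
          refine mul_le_mul_of_nonneg_right ?_ (norm_nonneg _)
          have hy' : -M < y := not_le.1 hy
          have hx : Real.exp (-(y + y₀)) ≤ Real.exp (L - y₀ / 2) := by
            rw [Real.exp_le_exp]; linarith
          have h1 : ∀ t ∈ Ico (xR (y + y₀)) 0, ‖‖g t‖‖ ≤ B := by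
            intro t ht
            rw [norm_norm]
            refine hgB t ⟨?_, ht.2⟩
            have := ht.1
            unfold xR at this
            linarith
          have h2 := norm_setIntegral_le_of_norm_le_const (μ := volume) (by simp) h1
          rw [Real.norm_of_nonneg (integral_nonneg fun _ => norm_nonneg _)] at h2
          refine h2.trans (mul_le_mul_of_nonneg_left ?_ hB)
          rw [measureReal_def, Real.volume_Ico, ENNReal.toReal_ofReal (by linarith [xR_neg (y + y₀)])]
          unfold xR
          linarith
    _ ≤ _ := by
        rw [integral_add ((hf.norm.indicator measurableSet_Iic).const_mul G) (hf.norm.const_mul _),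
          integral_const_mul, integral_const_mul, integral_indicator measurableSet_Iic]
        have := integral_norm_Iic_le hα hM (by linarith) hdecay
        gcongr

lemma ft_tr (f : ℝ → ℂ) (y₀ p : ℝ) :
    ft (tr f y₀) p = Complex.exp (-Complex.I * (p : ℂ) * (y₀ : ℂ)) * ft f p := by
  unfold ft tr
  have := integral_sub_right_eq_self
    (fun y => f y * Complex.exp (-Complex.I * (p : ℂ) * ((y + y₀ : ℝ) : ℂ))) y₀ (μ := volume)
  simp only [sub_add_cancel] at this
  rw [this, mul_left_comm, ← integral_const_mul (Complex.exp (-Complex.I * (p : ℂ) * (y₀ : ℂ)))]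
  refine congrArg _ (integral_congr_ae (.of_forall fun y => ?_))
  beta_reduce
  rw [show -Complex.I * (p : ℂ) * ((y + y₀ : ℝ) : ℂ) = -Complex.I * (p : ℂ) * (y₀ : ℂ) +
    -Complex.I * (p : ℂ) * (y : ℂ) by push_cast; ring, Complex.exp_add]
  ring

lemma exists_sq_norm_Aip_add_sq_norm_Bip_le (f g : ℝ → ℂ) (hf : Integrable f)
    (hfp : ∀ᵐ p : ℝ, p ≤ 0 → ft f p = 0) (hg : Integrable g)
    (hgp : ∀ᵐ k : ℝ, k ≤ 0 → ft g k = 0)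
    (gL : ℂ) (hgl : Tendsto g (nhdsWithin 0 (Iio 0)) (nhds gL))
    (α C L : ℝ) (hα : 0 < α) (hC : 0 < C) (hL : 0 ≤ L)
    (hdecay : ∀ y : ℝ, y ≤ -L → ‖f y‖ ≤ C / |y| ^ (1 + α)) :
    ∃ Y : ℝ, ∀ y₀ : ℝ, Y ≤ y₀ →
      ‖Aip xR g (tr f y₀)‖ ^ 2 + ‖Bip xR g (tr f y₀)‖ ^ 2 ≤
        (∫ t in Iio (0:ℝ), ‖g t‖) ^ 2 * (4 * C ^ 2 / (α ^ 2 * (y₀ / 2 + L) ^ (2 * α))) := by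
  set G := ∫ t in Iio (0:ℝ), ‖g t‖ with hG
  have hG0 : 0 ≤ G := integral_nonneg fun _ => norm_nonneg _
  set B := ‖gL‖ + 1
  obtain ⟨η, hη, hgB⟩ : ∃ η > 0, ∀ t ∈ Ioo (-η) 0, ‖g t‖ ≤ B := by
    have h1 : ∀ᶠ t in nhdsWithin (0:ℝ) (Iio 0), ‖g t‖ < B :=
      (hgl.norm).eventually_lt_const (lt_add_one _)
    rw [eventually_nhdsWithin_iff, Metric.eventually_nhds_iff_ball] at h1
    obtain ⟨η, hη, h⟩ := h1
    refine ⟨η, hη, fun t ht => (h t ?_ ht.2).le⟩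
    rw [Metric.mem_ball, Real.dist_eq, sub_zero, abs_lt]
    exact ⟨ht.1, ht.2.trans hη⟩
  have hf0 : ∀ y₀, ∫ y, tr f y₀ y = 0 := fun y₀ => by
    unfold tr
    rw [integral_sub_right_eq_self, integral_eq_zero_of_ft_eq_zero hf hfp]
  have hft : ∀ y₀, Integrable (tr f y₀) := fun y₀ => hf.comp_sub_right y₀
  have hmt : Tendsto (fun y₀ : ℝ => y₀ / 2 + L) atTop atTop :=
    tendsto_atTop_add_const_right _ _ (tendsto_id.atTop_div_const (by norm_num))
  have e1 : ∀ᶠ y₀ : ℝ in atTop, Real.exp (L - y₀ / 2) < η := by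
    have : Tendsto (fun y₀ : ℝ => Real.exp (2 * L) * Real.exp (-(y₀ / 2 + L))) atTop (nhds 0) := by
      simpa using (Real.tendsto_exp_neg_atTop_nhds_zero.comp hmt).const_mul (Real.exp (2 * L))
    filter_upwards [this.eventually_lt_const hη] with y₀ hy₀
    rwa [← Real.exp_add, show 2 * L + -(y₀ / 2 + L) = L - y₀ / 2 by ring] at hy₀
  have key : ∀ᶠ y₀ : ℝ in atTop, ∫ y, ‖tr f y₀ y‖ * ∫ t in Ico (xR y) 0, ‖g t‖ ≤
      2 * (G * (C / (α * (y₀ / 2 + L) ^ α))) := by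
    rcases hG0.eq_or_lt with h0 | hpos
    · refine .of_forall fun y₀ => ?_
      rw [← h0]
      simp only [zero_mul, mul_zero]
      refine integral_nonpos fun y => ?_
      have h1 : ∫ t in Ico (xR y) 0, ‖g t‖ ≤ G :=
        setIntegral_mono_set hg.norm.integrableOn (.of_forall fun _ => norm_nonneg _)
          (Ico_subset_Iio_self).eventuallyLE
      exact mul_nonpos_of_nonneg_of_nonpos (norm_nonneg _) (h1.trans h0.symm.le)
    · have ht : Tendsto (fun y₀ : ℝ => B * Real.exp (2 * L) * (∫ y, ‖f y‖) *
          ((y₀ / 2 + L) ^ α * Real.exp (-1 * (y₀ / 2 + L)))) atTop (nhds 0) := by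
        simpa using ((tendsto_rpow_mul_exp_neg_mul_atTop_nhds_zero α 1 one_pos).comp hmt).const_mul
          (B * Real.exp (2 * L) * (∫ y, ‖f y‖))
      filter_upwards [e1, ht.eventually_lt_const (show 0 < G * C / α by positivity),
        eventually_gt_atTop 0] with y₀ h1 h2 h3
      have hM : 0 < y₀ / 2 + L := by positivity
      have := integral_norm_tr_mul_le hf hg hα hM h3.le hdecay (by positivity) hgB h1
      refine this.trans ?_
      rw [two_mul]
      refine add_le_add le_rfl ?_
      have hMα : 0 < (y₀ / 2 + L) ^ α := Real.rpow_pos_of_pos hM _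
      rw [show L - y₀ / 2 = 2 * L + -1 * (y₀ / 2 + L) by ring, Real.exp_add]
      rw [show G * (C / (α * (y₀ / 2 + L) ^ α)) = G * C / α / (y₀ / 2 + L) ^ α by
        field_simp, le_div_iff₀ hMα]
      refine le_trans (le_of_eq ?_) h2.le
      ring
  obtain ⟨Y, hY⟩ := eventually_atTop.1 (key.and (eventually_gt_atTop 0))
  refine ⟨Y, fun y₀ hy₀ => ?_⟩
  obtain ⟨h1, h2⟩ := hY y₀ hy₀
  have hM : 0 < y₀ / 2 + L := by positivity
  have hA := norm_Aip_le continuous_xR (fun y => (xR_neg y).le) hg hgp (hft y₀) (hf0 y₀)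
  have hB := norm_Bip_le continuous_xR (fun y => (xR_neg y).le) hg hgp (hft y₀) (hf0 y₀)
  set a := G * (C / (α * (y₀ / 2 + L) ^ α)) with ha
  have hA' : ‖Aip xR g (tr f y₀)‖ ≤ a := by linarith
  have hB' : ‖Bip xR g (tr f y₀)‖ ≤ a := by linarith
  have e : G ^ 2 * (4 * C ^ 2 / (α ^ 2 * (y₀ / 2 + L) ^ (2 * α))) = 4 * a ^ 2 := by
    rw [ha, mul_comm 2 α, Real.rpow_mul hM.le, Real.rpow_two]
    field_simp
  rw [e]
  nlinarith [norm_nonneg (Aip xR g (tr f y₀)), norm_nonneg (Bip xR g (tr f y₀))]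

lemma integrableOn_rpow_mul_exp_neg_mul_Ioi {s b : ℝ} (hs : -1 < s) (hb : 0 < b) :
    IntegrableOn (fun t : ℝ => t ^ s * Real.exp (-b * t)) (Ioi 0) := by
  simpa using integrableOn_rpow_mul_exp_neg_mul_rpow (p := 1) hs one_pos hb

lemma integrableOn_cpow_mul_exp_neg_mul {a r : ℂ} (ha : 0 < a.re) (hr : 0 < r.re) :
    IntegrableOn (fun t : ℝ => (t : ℂ) ^ (a - 1) * Complex.exp (-(r * t))) (Ioi 0) := by
  have h : IntegrableOn (fun t : ℝ => t ^ (a.re - 1) * Real.exp (-r.re * t)) (Ioi 0) :=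
    integrableOn_rpow_mul_exp_neg_mul_Ioi (by linarith) hr
  refine Integrable.mono' h ?_ ?_
  · refine ContinuousOn.aestronglyMeasurable ?_ measurableSet_Ioi
    refine ContinuousOn.mul (fun t ht => ?_) (by fun_prop)
    exact (Complex.continuousAt_ofReal_cpow_const _ _ (Or.inr (ne_of_gt ht))).continuousWithinAt
  · filter_upwards [ae_restrict_mem measurableSet_Ioi] with t ht
    rw [norm_mul, Complex.norm_cpow_eq_rpow_re_of_pos ht, Complex.norm_exp]
    simp

lemma hasDerivAt_integral_cpow_mul_exp_neg_mul {a r : ℂ} (ha : 0 < a.re) (hr : 0 < r.re) :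
    HasDerivAt (fun z : ℂ => ∫ t in Ioi (0:ℝ), (t : ℂ) ^ (a - 1) * Complex.exp (-(z * t)))
      (∫ t in Ioi (0:ℝ), (t : ℂ) ^ (a - 1) * (Complex.exp (-(r * t)) * -t)) r := by
  have hre : ∀ z ∈ Metric.ball r (r.re / 2), r.re / 2 < z.re := by
    intro z hz
    have h1 : |(z - r).re| ≤ ‖z - r‖ := Complex.abs_re_le_norm _
    rw [← dist_eq_norm] at h1
    have h2 : dist z r < r.re / 2 := hz
    have := (abs_le.1 (h1.trans h2.le)).1
    have := (abs_lt.1 (h1.trans_lt h2)).1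
    rw [Complex.sub_re] at this
    linarith
  have hb : IntegrableOn (fun t : ℝ => t ^ a.re * Real.exp (-(r.re / 2) * t)) (Ioi 0) :=
    integrableOn_rpow_mul_exp_neg_mul_Ioi (by linarith) (half_pos hr)
  refine (hasDerivAt_integral_of_dominated_loc_of_deriv_le (μ := volume.restrict (Ioi (0:ℝ)))
    (Metric.ball_mem_nhds r (half_pos hr)) (F := fun (z : ℂ) (t : ℝ) => (t : ℂ) ^ (a - 1) * Complex.exp (-(z * t)))
    (F' := fun (z : ℂ) (t : ℝ) => (t : ℂ) ^ (a - 1) * (Complex.exp (-(z * t)) * -t))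
    (bound := fun t : ℝ => t ^ a.re * Real.exp (-(r.re / 2) * t)) ?_
    (integrableOn_cpow_mul_exp_neg_mul ha hr) ?_ ?_ hb ?_).2
  · filter_upwards [Metric.ball_mem_nhds r (half_pos hr)] with z hz
    exact (integrableOn_cpow_mul_exp_neg_mul ha ((half_pos hr).trans (hre z hz))).aestronglyMeasurable
  · refine ContinuousOn.aestronglyMeasurable ?_ measurableSet_Ioi
    refine ContinuousOn.mul (fun t ht => ?_) (by fun_prop)
    exact (Complex.continuousAt_ofReal_cpow_const _ _ (Or.inr (ne_of_gt ht))).continuousWithinAt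
  · filter_upwards [ae_restrict_mem measurableSet_Ioi] with t ht z hz
    have ht' : 0 < t := ht
    rw [norm_mul, norm_mul, Complex.norm_cpow_eq_rpow_re_of_pos ht', Complex.norm_exp, norm_neg,
      Complex.norm_real, Real.norm_of_nonneg ht'.le, mul_comm (Real.exp _), ← mul_assoc]
    have : t ^ (a - 1).re * t = t ^ a.re := by
      rw [Complex.sub_re, Complex.one_re, ← Real.rpow_add_one ht'.ne']
      simp
    rw [this]
    gcongr
    have := hre z hz
    simp only [Complex.neg_re, Complex.mul_re, Complex.ofReal_re, Complex.ofReal_im, mul_zero, sub_zero]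
    nlinarith
  · refine .of_forall fun t z _ => ?_
    have := ((hasDerivAt_id z).mul_const (t : ℂ)).neg.cexp.const_mul ((t : ℂ) ^ (a - 1))
    simpa using this

/-- The Gamma integral with a complex rate in the right half-plane. -/
lemma integral_cpow_mul_exp_neg_mul_Ioi_of_re_pos {a r : ℂ} (ha : 0 < a.re) (hr : 0 < r.re) :
    ∫ t in Ioi (0:ℝ), (t : ℂ) ^ (a - 1) * Complex.exp (-(r * t)) =
      (1 / r) ^ a * Complex.Gamma a := by
  let U : Set ℂ := {z | 0 < z.re}
  have hU : IsOpen U := isOpen_lt continuous_const Complex.continuous_re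
  have hUc : IsPreconnected U := (convex_halfSpace_re_gt 0).isPreconnected
  have h1 : AnalyticOnNhd ℂ
      (fun z : ℂ => ∫ t in Ioi (0:ℝ), (t : ℂ) ^ (a - 1) * Complex.exp (-(z * t))) U :=
    DifferentiableOn.analyticOnNhd (fun z hz =>
      (hasDerivAt_integral_cpow_mul_exp_neg_mul ha hz).differentiableAt.differentiableWithinAt) hU
  have h2 : AnalyticOnNhd ℂ (fun z : ℂ => (1 / z) ^ a * Complex.Gamma a) U := by
    refine DifferentiableOn.analyticOnNhd (fun z hz => ?_) hU
    have hz' : 0 < z.re := hz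
    have hz0 : z ≠ 0 := by rintro rfl; simp at hz'
    refine DifferentiableAt.differentiableWithinAt ?_
    refine ((DifferentiableAt.div (by fun_prop) differentiableAt_fun_id hz0).cpow_const ?_).mul_const _
    refine Complex.mem_slitPlane_iff.2 (Or.inl ?_)
    rw [Pi.div_apply, one_div, Complex.inv_re]
    exact div_pos hz' (Complex.normSq_pos.2 hz0)
  refine h1.eqOn_of_preconnected_of_frequently_eq h2 hUc (z₀ := 1) (by simp [U]) ?_ hr
  have ht : Tendsto (fun x : ℝ => (x : ℂ)) (nhdsWithin 1 {1}ᶜ) (nhdsWithin 1 {1}ᶜ) := by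
    refine tendsto_nhdsWithin_iff.2 ⟨?_, ?_⟩
    · have := (Complex.continuous_ofReal.tendsto (1:ℝ)).mono_left (nhdsWithin_le_nhds (s := {1}ᶜ))
      simpa using this
    · filter_upwards [self_mem_nhdsWithin] with x hx
      simpa using hx
  refine ht.frequently (Eventually.frequently ?_)
  filter_upwards [mem_nhdsWithin_of_mem_nhds (lt_mem_nhds (show (0:ℝ) < 1 by norm_num))] with x hx
  exact Complex.integral_cpow_mul_exp_neg_mul_Ioi ha hx

/-- The regularised oscillating kernel `exp (δ u - (δ + i) e^u)`; at `δ = 0` it is `exp (-i e^u)`. -/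
noncomputable def regKer (δ u : ℝ) : ℂ :=
  Complex.exp ((δ : ℂ) * u - ((δ : ℂ) + Complex.I) * (Real.exp u : ℂ))

/-- The Fourier transform of `regKer δ` at angular frequency `p`. -/
noncomputable def regKerFT (δ p : ℝ) : ℂ :=
  (1 / ((δ : ℂ) + Complex.I)) ^ ((δ : ℂ) - Complex.I * p) * Complex.Gamma ((δ : ℂ) - Complex.I * p)

lemma continuous_regKer (δ : ℝ) : Continuous (regKer δ) := by
  unfold regKer
  fun_prop

lemma continuous_regKer_left (u : ℝ) : Continuous (fun δ => regKer δ u) := by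
  unfold regKer
  fun_prop

lemma norm_regKer_le_one {δ : ℝ} (hδ : 0 ≤ δ) (u : ℝ) : ‖regKer δ u‖ ≤ 1 := by
  unfold regKer
  rw [Complex.norm_exp, Real.exp_le_one_iff]
  simp only [Complex.sub_re, Complex.mul_re, Complex.ofReal_re, Complex.ofReal_im, Complex.add_re,
    Complex.I_re, Complex.add_im, Complex.I_im]
  nlinarith [Real.add_one_le_exp u]

lemma exp_mul_regKer_eq (δ p u : ℝ) :
    Complex.exp (-Complex.I * p * u) * regKer δ u = Real.exp u •
      (((Real.exp u : ℝ) : ℂ) ^ ((δ : ℂ) - Complex.I * p - 1) *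
        Complex.exp (-(((δ : ℂ) + Complex.I) * (Real.exp u : ℝ)))) := by
  unfold regKer
  rw [Complex.real_smul, Complex.cpow_def_of_ne_zero (by exact_mod_cast (Real.exp_pos u).ne'),
    ← Complex.ofReal_log (Real.exp_pos u).le, Real.log_exp, Complex.ofReal_exp, ← Complex.exp_add,
    ← Complex.exp_add, ← Complex.exp_add]
  congr 1
  ring

lemma integrable_regKer {δ : ℝ} (hδ : 0 < δ) : Integrable (regKer δ) := by
  have h := integrableOn_cpow_mul_exp_neg_mul (a := (δ : ℂ)) (r := (δ : ℂ) + Complex.I)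
    (by simpa using hδ) (by simpa using hδ)
  rw [← Real.range_exp, ← image_univ, integrableOn_image_iff_integrableOn_abs_deriv_smul
    MeasurableSet.univ (fun x _ => (Real.hasDerivAt_exp x).hasDerivWithinAt)
    Real.exp_injective.injOn, integrableOn_univ] at h
  refine h.congr (.of_forall fun u => ?_)
  have := exp_mul_regKer_eq δ 0 u
  simp only [Complex.ofReal_zero, mul_zero, zero_mul, Complex.exp_zero, one_mul, sub_zero] at this
  rw [this]
  simp only [abs_of_pos (Real.exp_pos u)]

lemma integral_exp_mul_regKer {δ : ℝ} (hδ : 0 < δ) (p : ℝ) :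
    ∫ u : ℝ, Complex.exp (-Complex.I * p * u) * regKer δ u = regKerFT δ p := by
  unfold regKerFT
  rw [← integral_cpow_mul_exp_neg_mul_Ioi_of_re_pos (a := (δ : ℂ) - Complex.I * p)
    (r := (δ : ℂ) + Complex.I) (by simpa using hδ) (by simpa using hδ),
    ← Real.range_exp, ← image_univ, integral_image_eq_integral_abs_deriv_smul
    MeasurableSet.univ (fun x _ => (Real.hasDerivAt_exp x).hasDerivWithinAt)
    Real.exp_injective.injOn, setIntegral_univ]
  refine integral_congr_ae (.of_forall fun u => ?_)
  simp only [abs_of_pos (Real.exp_pos u)]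
  exact exp_mul_regKer_eq δ p u

lemma fourier_regKer {δ : ℝ} (hδ : 0 < δ) (ξ : ℝ) :
    FourierTransform.fourier (regKer δ) ξ = regKerFT δ (2 * Real.pi * ξ) := by
  rw [← integral_exp_mul_regKer hδ, Real.fourier_eq']
  refine integral_congr_ae (.of_forall fun v => ?_)
  simp only [smul_eq_mul, RCLike.inner_apply, conj_trivial]
  congr 2
  push_cast
  ring

lemma norm_Gamma_le {s : ℂ} (hs : 0 < s.re) : ‖Complex.Gamma s‖ ≤ Real.Gamma s.re := by
  rw [Complex.Gamma_eq_integral hs, Real.Gamma_eq_integral hs]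
  unfold Complex.GammaIntegral
  refine (norm_integral_le_integral_norm _).trans (le_of_eq ?_)
  refine setIntegral_congr_fun measurableSet_Ioi fun t ht => ?_
  simp only [norm_mul, Complex.norm_cpow_eq_rpow_re_of_pos ht, Complex.norm_real,
    Real.norm_of_nonneg (Real.exp_pos _).le, Complex.sub_re, Complex.one_re]

lemma real_Gamma_one_add_le_one {δ : ℝ} (h0 : 0 ≤ δ) (h1 : δ ≤ 1) : Real.Gamma (1 + δ) ≤ 1 := by
  have := Real.convexOn_Gamma.2 (show (1:ℝ) ∈ Ioi 0 by simp) (show (2:ℝ) ∈ Ioi 0 by simp)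
    (sub_nonneg.2 h1) h0 (by ring)
  simp only [smul_eq_mul, Real.Gamma_one, Real.Gamma_two] at this
  rw [show 1 + δ = (1 - δ) * 1 + δ * 2 by ring]
  linarith

lemma sub_I_mul_ne_neg_nat {δ p : ℝ} (hp : p ≠ 0) (m : ℕ) : (δ : ℂ) - Complex.I * p ≠ -m := by
  intro h
  have := congrArg Complex.im h
  simp at this
  exact hp this

lemma norm_regKerFT_le {δ p : ℝ} (h0 : 0 < δ) (h1 : δ ≤ 1) (hp : 0 < p) :
    ‖regKerFT δ p‖ ≤ 1 / p := by
  have hz : (δ : ℂ) + Complex.I ≠ 0 := by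
    intro h
    have := congrArg Complex.im h
    simp at this
  have hz1 : 1 ≤ ‖(δ : ℂ) + Complex.I‖ := by
    have := Complex.abs_im_le_norm ((δ : ℂ) + Complex.I)
    simpa using this
  have hn : ‖(1 / ((δ : ℂ) + Complex.I)) ^ ((δ : ℂ) - Complex.I * p)‖ ≤ 1 := by
    rw [Complex.norm_cpow_of_ne_zero (by simpa using hz)]
    refine div_le_one_of_le₀ ?_ (Real.exp_pos _).le
    have e1 : ‖1 / ((δ : ℂ) + Complex.I)‖ ^ ((δ : ℂ) - Complex.I * p).re ≤ 1 := by
      refine Real.rpow_le_one (norm_nonneg _) ?_ (by simpa using h0.le)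
      rw [norm_div, norm_one]
      exact div_le_one_of_le₀ hz1 (norm_nonneg _)
    refine e1.trans (Real.one_le_exp ?_)
    have : Complex.arg (1 / ((δ : ℂ) + Complex.I)) ≤ 0 := by
      refine (Complex.arg_neg_iff.2 ?_).le
      rw [one_div, Complex.inv_im]
      refine div_neg_of_neg_of_pos (by simp) (Complex.normSq_pos.2 hz)
    have hi : ((δ : ℂ) - Complex.I * p).im = -p := by simp
    rw [hi]
    nlinarith
  have hG : ‖Complex.Gamma ((δ : ℂ) - Complex.I * p)‖ ≤ 1 / p := by
    have ha : (δ : ℂ) - Complex.I * p ≠ 0 := by simpa using sub_I_mul_ne_neg_nat (δ := δ) hp.ne' 0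
    have h2 := Complex.Gamma_add_one _ ha
    have h3 := norm_Gamma_le (s := (δ : ℂ) - Complex.I * p + 1) (by simp; linarith)
    have h4 : p ≤ ‖(δ : ℂ) - Complex.I * p‖ := by
      have := Complex.abs_im_le_norm ((δ : ℂ) - Complex.I * p)
      simpa [abs_of_pos hp] using this
    have h5 : ((δ : ℂ) - Complex.I * p + 1).re = 1 + δ := by simp [add_comm]
    rw [h5, h2, norm_mul] at h3
    rw [le_div_iff₀ hp]
    have := real_Gamma_one_add_le_one h0.le h1
    nlinarith [norm_nonneg (Complex.Gamma ((δ : ℂ) - Complex.I * p))]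
  unfold regKerFT
  rw [norm_mul]
  calc _ ≤ 1 * (1 / p) := by gcongr
    _ = _ := one_mul _

lemma tendsto_regKerFT {p : ℝ} (hp : p ≠ 0) :
    Tendsto (fun δ => regKerFT δ p) (nhdsWithin 0 (Ioi 0)) (nhds (regKerFT 0 p)) := by
  have : ContinuousAt (fun δ => regKerFT δ p) 0 := by
    unfold regKerFT
    refine ContinuousAt.mul (ContinuousAt.cpow ?_ (by fun_prop) ?_) ?_
    · refine ContinuousAt.div (by fun_prop) (by fun_prop) (by simp)
    · refine Complex.mem_slitPlane_iff.2 (Or.inr ?_)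
      simp
    · refine ContinuousAt.comp (g := Complex.Gamma) ?_ (by fun_prop)
      exact (Complex.differentiableAt_Gamma _ (sub_I_mul_ne_neg_nat hp)).continuousAt
  exact this.tendsto.mono_left nhdsWithin_le_nhds

lemma sq_norm_regKerFT_zero {p : ℝ} (hp : 0 < p) :
    ‖regKerFT 0 p‖ ^ 2 = 2 * Real.pi / (p * (Real.exp (2 * Real.pi * p) - 1)) := by
  have h1 : ‖(1 / (((0:ℝ) : ℂ) + Complex.I)) ^ (((0:ℝ) : ℂ) - Complex.I * p)‖ ^ 2 =
      Real.exp (-(Real.pi * p)) := by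
    rw [Complex.norm_cpow_of_ne_zero (by simp)]
    have e1 : 1 / (((0:ℝ) : ℂ) + Complex.I) = -Complex.I := by simp
    have e2 : (((0:ℝ) : ℂ) - Complex.I * p).im = -p := by simp
    have e3 : (((0:ℝ) : ℂ) - Complex.I * p).re = 0 := by simp
    rw [e1, e2, e3, Complex.arg_neg_I, Real.rpow_zero, one_div, ← Real.exp_neg, ← Real.exp_nat_mul]
    congr 1
    push_cast
    ring
  have hp' : (p : ℂ) ≠ 0 := by exact_mod_cast hp.ne'
  have hs : 0 < Real.sinh (Real.pi * p) := Real.sinh_pos_iff.2 (by positivity)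
  have h2 : ‖Complex.Gamma (((0:ℝ) : ℂ) - Complex.I * p)‖ ^ 2 =
      Real.pi / (p * Real.sinh (Real.pi * p)) := by
    have r := Complex.Gamma_mul_Gamma_one_sub (Complex.I * p)
    have e1 : 1 - Complex.I * p = -(Complex.I * p) + 1 := by ring
    rw [e1, Complex.Gamma_add_one _ (by simpa using hp.ne')] at r
    have e2 : (Real.pi : ℂ) * (Complex.I * p) = ((Real.pi * p : ℝ) : ℂ) * Complex.I := by
      push_cast; ring
    rw [e2, Complex.sin_mul_I, ← Complex.ofReal_sinh] at r
    have e3 : Complex.Gamma (Complex.I * p) = (starRingEnd ℂ) (Complex.Gamma (-(Complex.I * p))) := by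
      rw [← Complex.Gamma_conj]
      simp
    rw [e3] at r
    rw [show ((0:ℝ) : ℂ) - Complex.I * p = -(Complex.I * p) by simp]
    have r2 : ((‖Complex.Gamma (-(Complex.I * p))‖ ^ 2 : ℝ) : ℂ) =
        ((Real.pi / (p * Real.sinh (Real.pi * p)) : ℝ) : ℂ) := by
      rw [← Complex.normSq_eq_norm_sq, Complex.normSq_eq_conj_mul_self]
      have hs' : ((Real.sinh (Real.pi * p) : ℝ) : ℂ) ≠ 0 := by exact_mod_cast hs.ne'
      push_cast at r hs' ⊢
      rw [eq_div_iff (by simp [hp', hs'])]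
      rw [eq_div_iff (by simp [hs'])] at r
      linear_combination r + ((starRingEnd ℂ) (Complex.Gamma (-(Complex.I * ↑p))) * Complex.Gamma (-(Complex.I * ↑p)) * p * Complex.sinh (Real.pi * p)) * Complex.I_sq
    exact_mod_cast r2
  unfold regKerFT
  rw [norm_mul, mul_pow, h1, h2, Real.sinh_eq]
  have e : Real.exp (2 * Real.pi * p) = Real.exp (Real.pi * p) * Real.exp (Real.pi * p) := by
    rw [← Real.exp_add]; ring_nf
  have hE : 1 < Real.exp (Real.pi * p) := Real.one_lt_exp_iff.2 (by positivity)
  rw [e, Real.exp_neg]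
  have : Real.exp (Real.pi * p) * Real.exp (Real.pi * p) - 1 ≠ 0 := by nlinarith
  have h3 : Real.exp (Real.pi * p) - (Real.exp (Real.pi * p))⁻¹ ≠ 0 := by
    have := inv_lt_one_of_one_lt₀ hE
    linarith
  have h4 : (Real.exp (Real.pi * p)) ≠ 0 := by positivity
  have h5 : Real.exp (Real.pi * p) - (Real.exp (Real.pi * p))⁻¹ =
    (Real.exp (Real.pi * p) * Real.exp (Real.pi * p) - 1) * (Real.exp (Real.pi * p))⁻¹ := by
    field_simp
  rw [h5]
  field_simp

open scoped FourierTransform SchwartzMap in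
/-- If a locally integrable function agrees, as a distribution away from the origin, with the
Fourier transform of a square-integrable function, then Plancherel's identity holds. -/
lemma eLpNorm_two_eq_of_integral_mul_fourier_eq {u v : ℝ → ℂ} (hu : MemLp u 2)
    (hv : LocallyIntegrableOn v {0}ᶜ)
    (h : ∀ φ : 𝓢(ℝ, ℂ), HasCompactSupport φ → tsupport φ ⊆ {0}ᶜ →
      ∫ x, (𝓕 φ) x * u x = ∫ x, φ x * v x) :
    eLpNorm v 2 = eLpNorm u 2 := by
  have hW : ∀ φ : 𝓢(ℝ, ℂ), ∫ x, φ x * (𝓕 (hu.toLp u) : Lp ℂ 2 (volume : Measure ℝ)) x =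
      ∫ x, (𝓕 φ) x * u x := by
    intro φ
    have h1 := congrArg (fun T => T φ) (Lp.fourier_toTemperedDistribution_eq (hu.toLp u))
    simp only [TemperedDistribution.fourier_apply, Lp.toTemperedDistribution_apply,
      smul_eq_mul] at h1
    rw [← h1]
    refine integral_congr_ae ?_
    filter_upwards [hu.coeFn_toLp] with x hx
    rw [hx]
  have hWi : LocallyIntegrable (𝓕 (hu.toLp u) : Lp ℂ 2 (volume : Measure ℝ)) :=
    (Lp.memLp _).locallyIntegrable (by norm_num)
  have hae : ∀ᵐ x : ℝ, x ∈ ({0}ᶜ : Set ℝ) →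
      (v - (𝓕 (hu.toLp u) : Lp ℂ 2 (volume : Measure ℝ))) x = 0 := by
    refine isOpen_compl_singleton.ae_eq_zero_of_integral_contDiff_smul_eq_zero
      (hv.sub (hWi.locallyIntegrableOn _)) fun g hg hgc hgs => ?_
    have hgc' : HasCompactSupport (fun x => (g x : ℂ)) := hgc.comp_left Complex.ofReal_zero
    have hgd : ContDiff ℝ (⊤ : ℕ∞) (fun x => (g x : ℂ)) := Complex.ofRealCLM.contDiff.comp hg
    have hts : tsupport (fun x => (g x : ℂ)) = tsupport g := by
      unfold tsupport
      congr 1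
      ext x
      simp
    have key := h (hgc'.toSchwartzMap hgd) hgc' (by
      change tsupport (fun x => (g x : ℂ)) ⊆ _
      rwa [hts])
    rw [← hW] at key
    have e : ∀ x, (hgc'.toSchwartzMap hgd) x = (g x : ℂ) := fun x => rfl
    simp only [e] at key
    simp only [Pi.sub_apply, smul_sub, Complex.real_smul]
    have i1 : Integrable (fun x => (g x : ℂ) * v x) := by
      have : IntegrableOn v (tsupport g) := hv.integrableOn_compact_subset hgs hgc
      have := this.continuousOn_mul (g := fun x => (g x : ℂ)) hgd.continuous.continuousOn hgc
      refine (integrableOn_iff_integrable_of_support_subset ?_).1 this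
      refine (Function.support_mul_subset_left _ _).trans ?_
      rw [← hts]
      exact subset_tsupport _
    have i2 : Integrable (fun x => (g x : ℂ) *
        (𝓕 (hu.toLp u) : Lp ℂ 2 (volume : Measure ℝ)) x) := by
      simpa using hWi.integrable_smul_left_of_hasCompactSupport
        (g := fun x => (g x : ℝ)) hg.continuous hgc
    rw [integral_sub i1 i2, ← key, sub_self]
  have hae' : v =ᵐ[volume] (𝓕 (hu.toLp u) : Lp ℂ 2 (volume : Measure ℝ)) := by
    filter_upwards [hae, compl_mem_ae_iff.2 (measure_singleton (0:ℝ))] with x h1 h2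
    exact sub_eq_zero.1 (h1 h2)
  rw [eLpNorm_congr_ae hae', ← eLpNorm_congr_ae hu.coeFn_toLp, ← Lp.enorm_def, ← Lp.enorm_def]
  rw [← ofReal_norm, ← ofReal_norm, Lp.norm_fourier_eq]

open scoped FourierTransform SchwartzMap in
lemma integral_fourier_mul_fourier {F : ℝ → ℂ} (hF : Integrable F) (φ : 𝓢(ℝ, ℂ)) :
    ∫ x, (𝓕 φ) x * F x = ∫ x, φ x * 𝓕 F x := by
  have h := VectorFourier.integral_fourierIntegral_smul_eq_flip (L := innerₗ ℝ) (μ := volume)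
    (ν := volume) Real.continuous_fourierChar continuous_inner φ.integrable hF
  rw [flip_innerₗ] at h
  exact h

open scoped FourierTransform SchwartzMap in
lemma fourier_fourier_eq_comp_neg (φ : 𝓢(ℝ, ℂ)) (x : ℝ) : (𝓕 (𝓕 φ)) x = φ (-x) := by
  have h : 𝓕⁻ (𝓕 φ) = φ := FourierTransform.fourierInv_fourier_eq φ
  have h2 := congrArg (fun ψ : 𝓢(ℝ, ℂ) => ψ (-x)) h
  refine Eq.trans ?_ h2
  rw [SchwartzMap.fourierInv_coe, Real.fourierInv_eq_fourier_neg, neg_neg,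
    SchwartzMap.fourier_coe]

open scoped FourierTransform SchwartzMap in
/-- Plancherel's identity for a bounded limit of integrable functions whose Fourier transforms
converge away from the origin, valid even when both sides are infinite. -/
lemma eLpNorm_two_eq_of_tendsto_fourier {Φ v : ℝ → ℂ} {Φn : ℕ → ℝ → ℂ} {w : ℝ → ℝ} {A K : ℝ}
    (hΦn : ∀ n, Integrable (Φn n)) (hΦb : ∀ n x, ‖Φn n x‖ ≤ A)
    (hΦl : ∀ x, Tendsto (fun n => Φn n x) atTop (nhds (Φ x)))
    (hvl : ∀ᵐ x, Tendsto (fun n => 𝓕 (Φn n) x) atTop (nhds (v x)))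
    (hvw : ∀ n, ∀ᵐ x, ‖𝓕 (Φn n) x‖ ≤ w x) (hwK : ∀ᵐ x, w x ≤ K / |x|)
    (hw : MemLp v 2 → MemLp w 2) :
    eLpNorm v 2 = eLpNorm Φ 2 := by
  have hFc : ∀ n, Continuous (𝓕 (Φn n)) := fun n =>
    VectorFourier.fourierIntegral_continuous Real.continuous_fourierChar
      (L := innerₗ ℝ) continuous_inner (hΦn n)
  have hΦm : AEStronglyMeasurable Φ := aestronglyMeasurable_of_tendsto_ae atTop
    (fun n => (hΦn n).aestronglyMeasurable) (.of_forall hΦl)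
  have hvm : AEStronglyMeasurable v := aestronglyMeasurable_of_tendsto_ae atTop
    (fun n => (hFc n).aestronglyMeasurable) hvl
  have hΦA : ∀ x, ‖Φ x‖ ≤ A := fun x =>
    le_of_tendsto (hΦl x).norm (.of_forall fun n => hΦb n x)
  have hvK : ∀ᵐ x, ‖v x‖ ≤ K / |x| := by
    filter_upwards [hvl, ae_all_iff.2 hvw, hwK] with x h1 h2 h3
    exact le_of_tendsto h1.norm (.of_forall fun n => (h2 n).trans h3)
  have limΦ : ∀ φ : 𝓢(ℝ, ℂ), Tendsto (fun n => ∫ x, φ x * Φn n x) atTop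
      (nhds (∫ x, φ x * Φ x)) := by
    intro φ
    refine tendsto_integral_of_dominated_convergence (fun x => ‖φ x‖ * A)
      (fun n => φ.continuous.aestronglyMeasurable.mul (hΦn n).aestronglyMeasurable)
      (φ.integrable.norm.mul_const A) (fun n => .of_forall fun x => ?_)
      (.of_forall fun x => (hΦl x).const_mul _)
    rw [norm_mul]
    gcongr
    exact hΦb n x
  have hneg : eLpNorm (fun x => Φ (-x)) 2 = eLpNorm Φ 2 :=
    eLpNorm_comp_measurePreserving hΦm (Measure.measurePreserving_neg volume)
  by_cases hv2 : MemLp v 2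
  · rw [← hneg]
    refine (eLpNorm_two_eq_of_integral_mul_fourier_eq hv2 ?_ fun φ _ _ => ?_).symm
    · refine LocallyIntegrable.locallyIntegrableOn ?_ _
      refine (memLp_top_of_bound (hΦm.comp_measurePreserving
        (Measure.measurePreserving_neg volume)) A ?_).locallyIntegrable le_top
      exact .of_forall fun x => hΦA (-x)
    · have l1 : Tendsto (fun n => ∫ x, (𝓕 φ) x * 𝓕 (Φn n) x) atTop
          (nhds (∫ x, (𝓕 φ) x * v x)) := by
        refine tendsto_integral_of_dominated_convergence (fun x => ‖(𝓕 φ) x‖ * w x)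
          (fun n => (𝓕 φ).continuous.aestronglyMeasurable.mul (hFc n).aestronglyMeasurable)
          (((𝓕 φ).memLp 2).norm.integrable_mul (hw hv2)) (fun n => ?_) ?_
        · filter_upwards [hvw n] with x hx
          rw [norm_mul]
          gcongr
        · filter_upwards [hvl] with x hx
          exact hx.const_mul _
      have l2 := limΦ (𝓕 (𝓕 φ))
      simp only [integral_fourier_mul_fourier (hΦn _) (𝓕 φ)] at l2
      rw [tendsto_nhds_unique l1 l2]
      simp only [fourier_fourier_eq_comp_neg]
      rw [← integral_neg_eq_self]
      simp only [neg_neg]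
  by_cases hΦ2 : MemLp Φ 2
  · refine eLpNorm_two_eq_of_integral_mul_fourier_eq hΦ2 ?_ fun φ hφc hφs => ?_
    · have hKl : LocallyIntegrableOn (fun x : ℝ => K / |x|) {0}ᶜ := by
        refine ContinuousOn.locallyIntegrableOn ?_ isOpen_compl_singleton.measurableSet
        exact continuousOn_const.div continuous_abs.continuousOn fun x hx => by simpa using hx
      exact hKl.mono hvm (by
        filter_upwards [hvK] with x hx
        exact hx.trans (le_abs_self _))
    · have l2 := limΦ (𝓕 φ)
      simp only [integral_fourier_mul_fourier (hΦn _) φ] at l2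
      refine tendsto_nhds_unique l2 ?_
      have hi : Integrable (fun x => ‖φ x‖ * (K / |x|)) := by
        have hc : ContinuousOn (fun x => ‖φ x‖ * (K / |x|)) (tsupport φ) :=
          φ.continuous.norm.continuousOn.mul (continuousOn_const.div continuous_abs.continuousOn
            fun x hx => by simpa using hφs hx)
        refine (integrableOn_iff_integrable_of_support_subset ?_).1
          (hc.integrableOn_compact hφc)
        refine fun x hx => subset_tsupport _ fun h0 => hx ?_
        simp only [h0, norm_zero, zero_mul]
      refine tendsto_integral_of_dominated_convergence _
        (fun n => φ.continuous.aestronglyMeasurable.mul (hFc n).aestronglyMeasurable)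
        hi (fun n => ?_) ?_
      · filter_upwards [hvw n, hwK] with x hx hx2
        rw [norm_mul]
        gcongr
        exact hx.trans hx2
      · filter_upwards [hvl] with x hx
        exact hx.const_mul _
  · have e1 : eLpNorm v 2 = ∞ := by
      by_contra h
      exact hv2 ⟨hvm, lt_top_iff_ne_top.2 h⟩
    have e2 : eLpNorm Φ 2 = ∞ := by
      by_contra h
      exact hΦ2 ⟨hΦm, lt_top_iff_ne_top.2 h⟩
    rw [e1, e2]

section PlanckLaw

open scoped FourierTransform

lemma ft_two_pi_mul (f : ℝ → ℂ) (ξ : ℝ) :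
    ft f (2 * Real.pi * ξ) = (Real.sqrt (2 * Real.pi) : ℂ)⁻¹ * 𝓕 f ξ := by
  unfold ft
  rw [Real.fourier_eq']
  refine congrArg _ (integral_congr_ae (.of_forall fun v => ?_))
  simp only [smul_eq_mul, RCLike.inner_apply, conj_trivial]
  rw [mul_comm]
  congr 2
  push_cast
  ring

lemma fourier_ae_eq_zero {f : ℝ → ℂ} (hfp : ∀ᵐ p : ℝ, p ≤ 0 → ft f p = 0) :
    ∀ᵐ ξ : ℝ, ξ ≤ 0 → 𝓕 f ξ = 0 := by
  have hq : Measure.QuasiMeasurePreserving (fun ξ : ℝ => 2 * Real.pi * ξ) :=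
    ⟨by fun_prop, by
      rw [Real.map_volume_mul_left (by positivity)]
      exact Measure.smul_absolutelyContinuous⟩
  filter_upwards [hq.ae hfp] with ξ h hξ
  have := h (mul_nonpos_of_nonneg_of_nonpos (by positivity) hξ)
  rw [ft_two_pi_mul] at this
  have hs : (Real.sqrt (2 * Real.pi) : ℂ)⁻¹ ≠ 0 := by
    rw [Ne, inv_eq_zero, Complex.ofReal_eq_zero]
    positivity
  exact (mul_eq_zero.1 this).resolve_left hs

lemma norm_fourier_le (f : ℝ → ℂ) (ξ : ℝ) : ‖𝓕 f ξ‖ ≤ ∫ y, ‖f y‖ :=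
  VectorFourier.norm_fourierIntegral_le_integral_norm _ _ _ _ _

lemma one_div_le_mul_norm_regKerFT_zero {p : ℝ} (h0 : 0 < p) (h1 : p ≤ 1) :
    1 / p ≤ Real.exp Real.pi * ‖regKerFT 0 p‖ := by
  refine le_of_sq_le_sq ?_ (by positivity)
  rw [mul_pow, sq_norm_regKerFT_zero h0, ← Real.exp_nat_mul]
  have hx : 0 < 2 * Real.pi * p := by positivity
  have e1 : 0 < Real.exp (2 * Real.pi * p) - 1 := by
    linarith [Real.one_lt_exp_iff.2 hx]
  have e2 : Real.exp (2 * Real.pi * p) - 1 ≤ 2 * Real.pi * p * Real.exp (2 * Real.pi) := by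
    have h3 : Real.exp (2 * Real.pi * p) - 1 ≤ 2 * Real.pi * p * Real.exp (2 * Real.pi * p) := by
      have h4 := Real.add_one_le_exp (-(2 * Real.pi * p))
      have h5 : Real.exp (2 * Real.pi * p) * Real.exp (-(2 * Real.pi * p)) = 1 := by
        rw [← Real.exp_add]; simp
      nlinarith [Real.exp_pos (2 * Real.pi * p)]
    refine h3.trans ?_
    refine mul_le_mul_of_nonneg_left (Real.exp_le_exp.2 ?_) hx.le
    exact mul_le_of_le_one_right (by positivity) h1
  push_cast
  rw [← mul_div_assoc, div_pow, one_pow, div_le_div_iff₀ (by positivity) (by positivity)]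
  nlinarith [Real.exp_pos (2 * Real.pi)]

lemma memLp_two_inv_sqrt_one_add_sq : MemLp (fun x : ℝ => (Real.sqrt (1 + x ^ 2))⁻¹) 2 := by
  refine (memLp_two_iff_integrable_sq ?_).2 ?_
  · refine Continuous.aestronglyMeasurable ?_
    refine Continuous.inv₀ (by fun_prop) fun x => ?_
    positivity
  · refine integrable_inv_one_add_sq.congr (.of_forall fun x => ?_)
    simp only [inv_pow]
    rw [Real.sq_sqrt (by positivity)]

lemma one_div_le_two_mul_inv_sqrt {ξ : ℝ} (hξ : 1 ≤ 2 * Real.pi * ξ) :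
    1 / (2 * Real.pi * ξ) ≤ 2 * (Real.sqrt (1 + ξ ^ 2))⁻¹ := by
  have hp : 0 < 2 * Real.pi * ξ := by linarith
  have hξ0 : 0 < ξ := by
    by_contra h
    nlinarith [Real.pi_pos]
  have hle : ξ ≤ 2 * Real.pi * ξ := by nlinarith [Real.pi_gt_three]
  rw [← div_eq_mul_inv, div_le_div_iff₀ hp (by positivity), one_mul]
  refine Real.sqrt_le_iff.2 ⟨by positivity, ?_⟩
  nlinarith

/-- The Planck law at the level of square integrals. -/
lemma eLpNorm_fourier_mul_regKerFT {f : ℝ → ℂ} (hf : Integrable f)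
    (hfp : ∀ᵐ p : ℝ, p ≤ 0 → ft f p = 0) :
    eLpNorm (fun ξ : ℝ => 𝓕 f ξ * regKerFT 0 (2 * Real.pi * ξ)) 2 =
      eLpNorm (fun s : ℝ => ∫ y, f y * regKer 0 (s - y)) 2 := by
  have hδ : Tendsto (fun n : ℕ => 1 / ((n : ℝ) + 1)) atTop (nhdsWithin 0 (Ioi 0)) :=
    tendsto_nhdsWithin_iff.2 ⟨tendsto_one_div_add_atTop_nhds_zero_nat,
      .of_forall fun n => mem_Ioi.2 Nat.one_div_pos_of_nat⟩
  have hδ0 : ∀ n : ℕ, 0 < 1 / ((n : ℝ) + 1) := fun n => Nat.one_div_pos_of_nat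
  have hδ1 : ∀ n : ℕ, 1 / ((n : ℝ) + 1) ≤ 1 := fun n => by
    rw [div_le_one (by positivity)]
    linarith [(Nat.cast_nonneg n : (0:ℝ) ≤ n)]
  let Φn : ℕ → ℝ → ℂ := fun n => convolution f (regKer (1 / ((n : ℝ) + 1)))
    (ContinuousLinearMap.mul ℂ ℂ) volume
  have hΦe : ∀ n s, Φn n s = ∫ y, f y * regKer (1 / ((n : ℝ) + 1)) (s - y) := fun n s => rfl
  have hF : ∀ n ξ, 𝓕 (Φn n) ξ = 𝓕 f ξ * regKerFT (1 / ((n : ℝ) + 1)) (2 * Real.pi * ξ) := by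
    intro n ξ
    rw [← fourier_regKer (hδ0 n)]
    exact Real.fourier_mul_convolution_eq hf (integrable_regKer (hδ0 n)) ξ
  have h0 := fourier_ae_eq_zero hfp
  have hne : ∀ᵐ ξ : ℝ, ξ ≠ 0 := compl_mem_ae_iff.2 (measure_singleton (0:ℝ))
  have hbd : ∀ (n : ℕ) (s y : ℝ), ‖f y * regKer (1 / ((n : ℝ) + 1)) (s - y)‖ ≤ ‖f y‖ := by
    intro n s y
    rw [norm_mul]
    exact mul_le_of_le_one_right (norm_nonneg _) (norm_regKer_le_one (hδ0 n).le _)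
  refine eLpNorm_two_eq_of_tendsto_fourier (Φn := Φn) (A := ∫ y, ‖f y‖)
    (K := (∫ y, ‖f y‖) / (2 * Real.pi)) (w := fun ξ => ‖𝓕 f ξ‖ / (2 * Real.pi * |ξ|))
    (fun n => hf.integrable_convolution _ (integrable_regKer (hδ0 n))) (fun n s => ?_)
    (fun s => ?_) ?_ (fun n => ?_) (.of_forall fun ξ => ?_) fun hv => ?_
  · rw [hΦe]
    exact norm_integral_le_of_norm_le hf.norm (.of_forall fun y => hbd n s y)
  · simp only [hΦe]
    refine tendsto_integral_of_dominated_convergence _ (fun n => ?_) hf.norm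
      (fun n => .of_forall fun y => hbd n s y) (.of_forall fun y => ?_)
    · refine hf.aestronglyMeasurable.mul (Continuous.aestronglyMeasurable ?_)
      exact (continuous_regKer _).comp (by fun_prop)
    · refine Tendsto.const_mul _ ?_
      exact ((continuous_regKer_left (s - y)).tendsto 0).comp (hδ.mono_right nhdsWithin_le_nhds)
  · filter_upwards [hne] with ξ hξ
    simp only [hF]
    exact ((tendsto_regKerFT (by positivity)).comp hδ).const_mul _
  · filter_upwards [hne, h0] with ξ hξ hξ0
    rw [hF, norm_mul]
    rcases hξ.lt_or_gt with h | h
    · rw [hξ0 h.le]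
      simp
    · have := norm_regKerFT_le (hδ0 n) (hδ1 n) (p := 2 * Real.pi * ξ) (by positivity)
      rw [abs_of_pos h, div_eq_mul_one_div ‖𝓕 f ξ‖]
      gcongr
  · rw [div_div]
    gcongr
    exact norm_fourier_le f ξ
  · have hw : MemLp (fun ξ : ℝ => Real.exp Real.pi * ‖𝓕 f ξ * regKerFT 0 (2 * Real.pi * ξ)‖ +
        (∫ y, ‖f y‖) * 2 * (Real.sqrt (1 + ξ ^ 2))⁻¹) 2 :=
      (hv.norm.const_mul _).add (memLp_two_inv_sqrt_one_add_sq.const_mul _)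
    refine hw.mono' ?_ ?_
    · have hc : Continuous (𝓕 f) := VectorFourier.fourierIntegral_continuous
        Real.continuous_fourierChar (L := innerₗ ℝ) continuous_inner hf
      exact (hc.norm.measurable.div (by fun_prop)).aestronglyMeasurable
    · filter_upwards [hne, h0] with ξ hξ hξ0
      have hA : 0 ≤ ∫ y, ‖f y‖ := integral_nonneg fun _ => norm_nonneg _
      rw [Real.norm_of_nonneg (by positivity)]
      rcases hξ.lt_or_gt with h | h
      · rw [hξ0 h.le]
        simp only [norm_zero, zero_div]
        positivity
      · rw [abs_of_pos h, div_eq_mul_one_div]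
        rcases le_total (2 * Real.pi * ξ) 1 with h1 | h1
        · refine le_add_of_le_of_nonneg ?_ (by positivity)
          rw [norm_mul, mul_left_comm]
          gcongr
          exact one_div_le_mul_norm_regKerFT_zero (by positivity) h1
        · refine le_add_of_nonneg_of_le (by positivity) ?_
          rw [mul_assoc (∫ y, ‖f y‖)]
          exact mul_le_mul (norm_fourier_le f ξ) (one_div_le_two_mul_inv_sqrt h1)
            (by positivity) hA

lemma eLpNorm_two_sq_eq_lintegral (F : ℝ → ℂ) :
    eLpNorm F 2 ^ 2 = ∫⁻ x, ENNReal.ofReal (‖F x‖ ^ 2) := by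
  have h := eLpNorm_nnreal_pow_eq_lintegral (f := F) (p := 2) (μ := volume) two_ne_zero
  simp only [ENNReal.coe_ofNat, NNReal.coe_ofNat, ENNReal.rpow_ofNat] at h
  rw [h]
  refine lintegral_congr fun x => ?_
  rw [← ofReal_norm, ENNReal.ofReal_pow (norm_nonneg _)]

lemma norm_inv_sqrt_two_pi_sq : ‖(Real.sqrt (2 * Real.pi) : ℂ)⁻¹‖ ^ 2 = 1 / (2 * Real.pi) := by
  rw [norm_inv, Complex.norm_real, Real.norm_of_nonneg (Real.sqrt_nonneg _), inv_pow,
    Real.sq_sqrt (by positivity), one_div]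

lemma No_xR_eq (f : ℝ → ℂ) :
    No xR f = ENNReal.ofReal (1 / (4 * Real.pi)) *
      ∫⁻ s, ENNReal.ofReal (‖∫ y, f y * regKer 0 (s - y)‖ ^ 2) := by
  unfold No
  rw [← Real.range_exp, ← image_univ, lintegral_image_eq_lintegral_abs_deriv_mul
    MeasurableSet.univ (fun x _ => (Real.hasDerivAt_exp x).hasDerivWithinAt)
    Real.exp_injective.injOn, setLIntegral_univ, ← lintegral_const_mul' _ _ ENNReal.ofReal_ne_top]
  refine lintegral_congr fun s => ?_
  have e : Fk xR f (-Real.exp s) = (Real.sqrt (2 * Real.pi) : ℂ)⁻¹ *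
      ∫ y, f y * regKer 0 (s - y) := by
    unfold Fk regKer xR
    refine congrArg _ (integral_congr_ae (.of_forall fun y => ?_))
    beta_reduce
    rw [sub_eq_add_neg s y, Real.exp_add]
    congr 2
    push_cast
    ring
  rw [e, norm_mul, mul_pow, norm_inv_sqrt_two_pi_sq, abs_of_pos (Real.exp_pos s),
    ← ENNReal.ofReal_mul (Real.exp_pos s).le, ← ENNReal.ofReal_mul (by positivity)]
  congr 1
  have := (Real.exp_pos s).ne'
  field_simp
  ring

lemma Nth_two_pi_eq {f : ℝ → ℂ} (hfp : ∀ᵐ p : ℝ, p ≤ 0 → ft f p = 0) :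
    Nth (2 * Real.pi) f = ENNReal.ofReal (1 / (4 * Real.pi)) *
      ∫⁻ ξ, ENNReal.ofReal (‖𝓕 f ξ * regKerFT 0 (2 * Real.pi * ξ)‖ ^ 2) := by
  unfold Nth
  have hpi : 0 < 2 * Real.pi := by positivity
  have himg : (fun ξ : ℝ => 2 * Real.pi * ξ) '' Ioi 0 = Ioi 0 := by
    rw [image_mul_left_Ioi hpi, mul_zero]
  have hz : ∫⁻ ξ, ENNReal.ofReal (‖𝓕 f ξ * regKerFT 0 (2 * Real.pi * ξ)‖ ^ 2) =
      ∫⁻ ξ in Ioi 0, ENNReal.ofReal (‖𝓕 f ξ * regKerFT 0 (2 * Real.pi * ξ)‖ ^ 2) := by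
    rw [← lintegral_indicator measurableSet_Ioi]
    refine lintegral_congr_ae ?_
    filter_upwards [fourier_ae_eq_zero hfp] with ξ h
    by_cases hξ : ξ ∈ Ioi (0:ℝ)
    · rw [indicator_of_mem hξ]
    · rw [indicator_of_notMem hξ, h (not_lt.1 hξ)]
      simp
  have hd : ∀ x ∈ Ioi (0:ℝ), HasDerivWithinAt (fun ξ : ℝ => 2 * Real.pi * ξ) (2 * Real.pi) (Ioi 0) x :=
    fun x _ => by simpa using ((hasDerivAt_id x).const_mul (2 * Real.pi)).hasDerivWithinAt
  have hcv := lintegral_image_eq_lintegral_abs_deriv_mul measurableSet_Ioi hd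
    (mul_right_injective₀ hpi.ne').injOn
    (fun p => ENNReal.ofReal (‖ft f p‖ ^ 2 / (2 * p * (Real.exp (2 * Real.pi * p) - 1))))
  rw [himg] at hcv
  rw [hz, hcv, ← lintegral_const_mul' _ _ ENNReal.ofReal_ne_top]
  refine setLIntegral_congr_fun measurableSet_Ioi fun ξ hξ => ?_
  have hξ' : 0 < ξ := hξ
  have hp : 0 < 2 * Real.pi * ξ := by positivity
  have hE : 0 < Real.exp (2 * Real.pi * (2 * Real.pi * ξ)) - 1 := by
    linarith [Real.one_lt_exp_iff.2 (show 0 < 2 * Real.pi * (2 * Real.pi * ξ) by positivity)]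
  rw [ft_two_pi_mul, norm_mul, mul_pow, norm_inv_sqrt_two_pi_sq, norm_mul, mul_pow,
    sq_norm_regKerFT_zero hp, abs_of_pos hpi, ← ENNReal.ofReal_mul hpi.le,
    ← ENNReal.ofReal_mul (by positivity)]
  congr 1
  field_simp
  ring

/-- The mean number of particles created spontaneously by `xR` is given by the Planck law. -/
lemma No_xR_eq_Nth {f : ℝ → ℂ} (hf : Integrable f) (hfp : ∀ᵐ p : ℝ, p ≤ 0 → ft f p = 0) :
    No xR f = Nth (2 * Real.pi) f := by
  rw [No_xR_eq, Nth_two_pi_eq hfp, ← eLpNorm_two_sq_eq_lintegral, ← eLpNorm_two_sq_eq_lintegral,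
    eLpNorm_fourier_mul_regKerFT hf hfp]

end PlanckLaw

/-- For the relativistic map `x_R`, a normalized outgoing wave function
`f` with `|f(y)| ≤ C/|y|^{1+α}` for `y ≤ -L` and a normalized incoming wave function
`g` having a left limit `g(0⁻) = gL`, there is `Y` such that for all `y₀ ≥ Y`,
`|N̄_g[f_{y₀}] - N̄^Th_{2π}[f_{y₀}]| ≤ (∫_{-∞}^0|g|)² · 4C²/(α²(y₀/2+L)^{2α})
  + e^{2L-y₀}(∫|f|)² |g(0⁻)|²`: the stimulated mean particle number is thermal at
inverse temperature `2π` asymptotically close to the horizon. -/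
theorem stmt_14 (f g : ℝ → ℂ)
    (hf : MeasureTheory.Integrable f)
    (hfp : ∀ᵐ p : ℝ, p ≤ 0 → ft f p = 0)
    (hfn : (∫⁻ p in Set.Ioi (0:ℝ),
        ENNReal.ofReal (‖ft f p‖ ^ 2 / (2 * p))) = 1)
    (hg : MeasureTheory.Integrable g)
    (hgp : ∀ᵐ k : ℝ, k ≤ 0 → ft g k = 0)
    (hgn : (∫⁻ k in Set.Ioi (0:ℝ),
        ENNReal.ofReal (‖ft g k‖ ^ 2 / (2 * k))) = 1)
    (gL : ℂ) (hgl : Filter.Tendsto g (nhdsWithin 0 (Set.Iio 0)) (nhds gL))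
    (α C L : ℝ) (hα : 0 < α) (hC : 0 < C) (hL : 0 ≤ L)
    (hdecay : ∀ y : ℝ, y ≤ -L → ‖f y‖ ≤ C / |y| ^ (1 + α)) :
    ∃ Y : ℝ, ∀ y₀ : ℝ, Y ≤ y₀ →
      Ng xR g (tr f y₀) - Nth (2 * Real.pi) (tr f y₀) ≤
        ENNReal.ofReal ((∫ t in Set.Iio (0:ℝ), ‖g t‖) ^ 2 *
            (4 * C ^ 2 / (α ^ 2 * (y₀ / 2 + L) ^ (2 * α))) +
          Real.exp (2 * L - y₀) * (∫ y : ℝ, ‖f y‖) ^ 2 * ‖gL‖ ^ 2) ∧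
      Nth (2 * Real.pi) (tr f y₀) - Ng xR g (tr f y₀) ≤
        ENNReal.ofReal ((∫ t in Set.Iio (0:ℝ), ‖g t‖) ^ 2 *
            (4 * C ^ 2 / (α ^ 2 * (y₀ / 2 + L) ^ (2 * α))) +
          Real.exp (2 * L - y₀) * (∫ y : ℝ, ‖f y‖) ^ 2 * ‖gL‖ ^ 2) := by
  obtain ⟨Y, hY⟩ := exists_sq_norm_Aip_add_sq_norm_Bip_le f g hf hfp hg hgp gL hgl α C L
    hα hC hL hdecay
  refine ⟨Y, fun y₀ hy₀ => ?_⟩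
  have hN : No xR (tr f y₀) = Nth (2 * Real.pi) (tr f y₀) := by
    refine No_xR_eq_Nth (hf.comp_sub_right y₀) ?_
    filter_upwards [hfp] with p hp hp0
    rw [ft_tr, hp hp0, mul_zero]
  unfold Ng
  rw [hN, add_assoc, ← ENNReal.ofReal_add (by positivity) (by positivity)]
  refine ⟨add_tsub_le_left.trans (ENNReal.ofReal_le_ofReal ?_), ?_⟩
  · exact (hY y₀ hy₀).trans (le_add_of_nonneg_right (by positivity))
  · rw [tsub_eq_zero_of_le le_self_add]
    exact zero_le
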